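/- arXiv:1503.01871 — 3 statements merged into one kernel-verified Lean document; each statement's English description precedes it below -/
import Mathlib

section
/- Assume (H1). Then for every x₀ ∈ H there exists a unique strong global solution of the dynamical system ẋ(t) + x(t) = J_{λ(t)A}(x(t) − λ(t)D x(t) − λ(t)β(t)B x(t)), x(0) = x₀. -/
open scoped RealInnerProductSpace Pointwise
open MeasureTheory Filter

variable {H : Type*} [NormedAddCommGroup H] [InnerProductSpace ℝ H]

/-- A set-valued operator `A : H ⇒ H` (given by its value map) is monotone. -/
def MonotoneOperator (A : H → Set H) : Prop :=
  ∀ ⦃x u y v : H⦄, u ∈ A x → v ∈ A y → (0:ℝ) ≤ ⟪x - y, u - v⟫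

/-- `A` is maximally monotone: monotone and without proper monotone extension. -/
def MaximallyMonotone (A : H → Set H) : Prop :=
  MonotoneOperator A ∧ ∀ A' : H → Set H, MonotoneOperator A' → (∀ x, A x ⊆ A' x) → A' = A

/-- `A` is `γ`-strongly monotone. -/
def StronglyMonotoneOperator (γ : ℝ) (A : H → Set H) : Prop :=
  ∀ ⦃x u y v : H⦄, u ∈ A x → v ∈ A y → γ * ‖x - y‖ ^ 2 ≤ ⟪x - y, u - v⟫

/-- A single-valued operator `T` is `γ`-cocoercive. -/
def Cocoercive (γ : ℝ) (T : H → H) : Prop :=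
  ∀ x y : H, γ * ‖T x - T y‖ ^ 2 ≤ ⟪x - y, T x - T y⟫

/-- The normal cone of a set `C` at `z` (empty when `z ∉ C`). -/
def normalCone (C : Set H) (z : H) : Set H :=
  {u | z ∈ C ∧ ∀ y ∈ C, ⟪y - z, u⟫ ≤ (0:ℝ)}

/-- The support function `σ_C`, with values in `ℝ ∪ {±∞}`. -/
noncomputable def supportFn (C : Set H) (u : H) : EReal :=
  ⨆ y ∈ C, ((⟪y, u⟫ : ℝ) : EReal)

/-- The Fitzpatrick function of a single-valued operator `B`. -/
noncomputable def fitzpatrick (B : H → H) (x u : H) : EReal :=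
  ⨆ y : H, ((⟪x, B y⟫ + ⟪y, u⟫ - ⟪y, B y⟫ : ℝ) : EReal)

/-- Conversion of an extended real into `[0,∞]` (negative values go to `0`). -/
noncomputable def erealToENNReal (x : EReal) : ENNReal :=
  if x = ⊤ then ⊤ else ENNReal.ofReal x.toReal

/-- Absolute continuity of `f` on `[0,b]`, via the `ε`-`η` definition. -/
def AbsolutelyContinuousOnIcc (f : ℝ → H) (b : ℝ) : Prop :=
  ∀ ε > (0:ℝ), ∃ η > (0:ℝ), ∀ (n : ℕ) (a c : Fin n → ℝ),
    (∀ k, 0 ≤ a k ∧ a k ≤ c k ∧ c k ≤ b) →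
    (Pairwise fun i j => Disjoint (Set.Ioo (a i) (c i)) (Set.Ioo (a j) (c j))) →
    ∑ k, (c k - a k) < η → ∑ k, ‖f (c k) - f (a k)‖ < ε

/-- A strong global solution `x`, with derivative function `xd`, of the dynamical system
`ẋ(t) + x(t) = J_{λ(t)A}(x(t) − λ(t)Dx(t) − λ(t)β(t)Bx(t))`, `x(0) = x₀`, where the
resolvent equation is expressed as the differential inclusion
`x(t) − λ(t)Dx(t) − λ(t)β(t)Bx(t) − (ẋ(t)+x(t)) ∈ λ(t) A(ẋ(t)+x(t))`. -/
def IsStrongGlobalSolution (A : H → Set H) (D B : H → H) (lam beta : ℝ → ℝ)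
    (x₀ : H) (x xd : ℝ → H) : Prop :=
  (∀ b > (0:ℝ), AbsolutelyContinuousOnIcc x b) ∧ x 0 = x₀ ∧
  ∀ᵐ t ∂(volume.restrict (Set.Ici (0:ℝ))),
    HasDerivAt x (xd t) t ∧
    x t - lam t • D (x t) - (lam t * beta t) • B (x t) - (xd t + x t)
      ∈ lam t • A (xd t + x t)

/-- The solution set `zer(A + D + N_C)`. -/
def zerSum (A : H → Set H) (D : H → H) (C : Set H) : Set H :=
  {z | ∃ v ∈ A z, ∃ p ∈ normalCone C z, v + D z + p = 0}


/-- Working form of maximal monotonicity. -/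
def MaxMonAux (A : H → Set H) : Prop :=
  MonotoneOperator A ∧
    ∀ x u : H, (∀ y v : H, v ∈ A y → (0:ℝ) ≤ ⟪x - y, u - v⟫) → u ∈ A x

theorem MaximallyMonotone.aux {A : H → Set H} (hA : MaximallyMonotone A) : MaxMonAux A := by
  refine ⟨hA.1, fun x u hxu => ?_⟩
  have h := hA.2 (fun y => {v | v ∈ A y ∨ (y = x ∧ v = u)}) ?_ (fun y v hv => Or.inl hv)
  · rw [← h]; exact Or.inr ⟨rfl, rfl⟩
  · rintro a p b q (hp | ⟨rfl, rfl⟩) (hq | ⟨rfl, rfl⟩)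
    · exact hA.1 hp hq
    · have := hxu a p hp
      rwa [← neg_sub a, ← neg_sub p, inner_neg_neg] at this
    · exact hxu b q hq
    · simp

/-- Minimization of `r + ‖z‖²/2` over a closed convex set, with the optimality condition. -/
theorem exists_min_of_convex {E : Type*} [NormedAddCommGroup E] [InnerProductSpace ℝ E]
    [CompleteSpace E] (S : Set (E × ℝ)) (hne : S.Nonempty) (hcl : IsClosed S) (hcv : Convex ℝ S)
    (hb : ∀ p ∈ S, (0:ℝ) ≤ p.2 + ‖p.1‖ ^ 2 / 2) :
    ∃ q ∈ S, ∀ p ∈ S, q.2 + ‖q.1‖ ^ 2 ≤ p.2 + ⟪q.1, p.1⟫ := by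
  set G : E × ℝ → ℝ := fun p => p.2 + ‖p.1‖ ^ 2 / 2 with hG
  have hGc : Continuous G := by fun_prop
  set m := sInf (G '' S) with hm
  have hbdd : BddBelow (G '' S) := ⟨0, by rintro _ ⟨p, hp, rfl⟩; exact hb p hp⟩
  have hmle : ∀ p ∈ S, m ≤ G p := fun p hp => csInf_le hbdd ⟨p, hp, rfl⟩
  have hex : ∀ n : ℕ, ∃ p ∈ S, G p < m + 1 / ((n:ℝ) + 1) := by
    intro n
    have : sInf (G '' S) < m + 1 / ((n:ℝ) + 1) := by
      rw [← hm]; linarith [show (0:ℝ) < 1 / ((n:ℝ) + 1) by positivity]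
    obtain ⟨_, ⟨p, hp, rfl⟩, h⟩ := exists_lt_of_csInf_lt (hne.image G) this
    exact ⟨p, hp, h⟩
  choose z hzS hz using hex
  have hpar : ∀ p ∈ S, ∀ q ∈ S, ‖p.1 - q.1‖ ^ 2 ≤ 4 * (G p - m) + 4 * (G q - m) := by
    intro p hp q hq
    have h1 := hmle _ (hcv hp hq (by norm_num : (0:ℝ) ≤ 1/2) (by norm_num : (0:ℝ) ≤ 1/2)
      (by norm_num))
    simp only [hG, Prod.fst_add, Prod.snd_add, Prod.smul_fst, Prod.smul_snd, smul_eq_mul,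
      ← smul_add, norm_smul] at h1 ⊢
    have h2 := norm_add_sq_real p.1 q.1
    have h3 := norm_sub_sq_real p.1 q.1
    norm_num at h1
    nlinarith
  have hlim : Tendsto (fun n : ℕ => 1 / ((n:ℝ) + 1)) atTop (nhds 0) :=
    tendsto_one_div_add_atTop_nhds_zero_nat
  have hcau : CauchySeq (fun n => (z n).1) := by
    rw [Metric.cauchySeq_iff']
    intro ε hε
    obtain ⟨N, hN⟩ := (hlim.eventually (gt_mem_nhds (show (0:ℝ) < ε ^ 2 / 8 by positivity))).exists
    refine ⟨N, fun n hn => ?_⟩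
    have h1 := hpar _ (hzS n) _ (hzS N)
    have h2 : 1 / ((n:ℝ) + 1) ≤ 1 / ((N:ℝ) + 1) := by
      have : (N:ℝ) ≤ n := by exact_mod_cast hn
      gcongr
    have h3 := hz n
    have h4 := hz N
    rw [dist_eq_norm]
    refine lt_of_pow_lt_pow_left₀ 2 hε.le ?_
    linarith
  obtain ⟨a, ha⟩ := cauchySeq_tendsto_of_complete hcau
  have hGz : Tendsto (fun n => G (z n)) atTop (nhds m) := by
    refine tendsto_of_tendsto_of_tendsto_of_le_of_le tendsto_const_nhds
      (h := fun n : ℕ => m + 1 / ((n:ℝ) + 1)) ?_ (fun n => hmle _ (hzS n)) (fun n => (hz n).le)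
    simpa using hlim.const_add m
  have hr : Tendsto (fun n => (z n).2) atTop (nhds (m - ‖a‖ ^ 2 / 2)) := by
    have := hGz.sub ((ha.norm.pow 2).div_const 2)
    refine this.congr (fun n => ?_)
    simp [hG]
  have hq : (a, m - ‖a‖ ^ 2 / 2) ∈ S := by
    refine hcl.mem_of_tendsto (ha.prodMk_nhds hr) (Eventually.of_forall fun n => hzS n)
  refine ⟨_, hq, fun p hp => ?_⟩
  simp only
  have key : ∀ t : ℝ, 0 < t → t ≤ 1 →
      0 ≤ (p.2 - (m - ‖a‖ ^ 2 / 2) + ⟪a, p.1 - a⟫) + t * (‖p.1 - a‖ ^ 2 / 2) := by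
    intro t ht ht1
    have h1 := hmle _ (hcv hq hp (by linarith : (0:ℝ) ≤ 1 - t) ht.le (by ring))
    have e : (1 - t) • a + t • p.1 = a + t • (p.1 - a) := by
      rw [smul_sub, sub_smul, one_smul]; abel
    simp only [hG, Prod.fst_add, Prod.snd_add, Prod.smul_fst, Prod.smul_snd, smul_eq_mul, e] at h1
    rw [norm_add_sq_real, inner_smul_right, norm_smul, Real.norm_of_nonneg ht.le] at h1
    have : 0 ≤ t * ((p.2 - (m - ‖a‖ ^ 2 / 2) + ⟪a, p.1 - a⟫) + t * (‖p.1 - a‖ ^ 2 / 2)) := by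
      nlinarith
    exact nonneg_of_mul_nonneg_right this ht
  have h0 : 0 ≤ (p.2 - (m - ‖a‖ ^ 2 / 2) + ⟪a, p.1 - a⟫) := by
    have hc : Tendsto (fun n : ℕ => (p.2 - (m - ‖a‖ ^ 2 / 2) + ⟪a, p.1 - a⟫)
        + 1 / ((n:ℝ) + 1) * (‖p.1 - a‖ ^ 2 / 2)) atTop
        (nhds ((p.2 - (m - ‖a‖ ^ 2 / 2) + ⟪a, p.1 - a⟫) + 0 * (‖p.1 - a‖ ^ 2 / 2))) :=
      (hlim.mul_const _).const_add _
    have := ge_of_tendsto' hc (fun n => key _ (by positivity) (by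
      rw [div_le_one (by positivity)]; linarith [show (0:ℝ) ≤ n by positivity]))
    simpa using this
  rw [inner_sub_right, real_inner_self_eq_norm_sq] at h0
  linarith

/-- Minty: a maximally monotone operator satisfies `0 ∈ ran (I + A)`. -/
theorem MaxMonAux.exists_neg_mem [CompleteSpace H] {A : H → Set H} (hA : MaxMonAux A) :
    ∃ a : H, -a ∈ A a := by
  obtain ⟨y₀, v₀, h₀⟩ : ∃ y v, v ∈ A y := by
    by_contra! h
    exact h 0 0 (hA.2 0 0 fun y v hv => absurd hv (h y v))
  let S : Set (WithLp 2 (H × H) × ℝ) :=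
    {p | ∀ y v : H, v ∈ A y → ⟪p.1.fst, v⟫ + ⟪y, p.1.snd⟫ - ⟪y, v⟫ ≤ p.2}
  have hfst : Continuous (fun p : WithLp 2 (H × H) × ℝ => p.1.fst) := by fun_prop
  have hsnd : Continuous (fun p : WithLp 2 (H × H) × ℝ => p.1.snd) := by fun_prop
  have hgr : ∀ y v, v ∈ A y → ((WithLp.toLp 2 (y, v), ⟪y, v⟫) : WithLp 2 (H × H) × ℝ) ∈ S := by
    intro y v hv y' v' hv'
    have := hA.1 hv hv'
    simp only [inner_sub_left, inner_sub_right] at this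
    change ⟪y, v'⟫ + ⟪y', v⟫ - ⟪y', v'⟫ ≤ ⟪y, v⟫
    linarith
  have hlow : ∀ p ∈ S, ⟪p.1.fst, p.1.snd⟫ ≤ p.2 := by
    intro p hp
    by_contra! hlt
    have : p.1.snd ∈ A p.1.fst := by
      refine hA.2 _ _ fun y v hv => ?_
      have := hp y v hv
      simp only [inner_sub_left, inner_sub_right]
      linarith
    have := hp _ _ this
    linarith
  have hS1 : IsClosed S := by
    simp only [S, Set.ofPred_forall]
    refine isClosed_iInter fun y => isClosed_iInter fun v => isClosed_iInter fun _ => ?_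
    exact isClosed_le (by fun_prop) (by fun_prop)
  have hS2 : Convex ℝ S := by
    intro p hp q hq s t hs ht hst y v hv
    have h1 := mul_le_mul_of_nonneg_left (hp y v hv) hs
    have h2 := mul_le_mul_of_nonneg_left (hq y v hv) ht
    simp only [Prod.fst_add, Prod.smul_fst, Prod.snd_add, Prod.smul_snd, WithLp.add_fst,
      WithLp.add_snd, WithLp.smul_fst, WithLp.smul_snd, inner_add_left, inner_add_right,
      inner_smul_left, inner_smul_right, smul_eq_mul, conj_trivial]
    have : ⟪y, v⟫ = s * ⟪y, v⟫ + t * ⟪y, v⟫ := by rw [← add_mul, hst, one_mul]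
    linarith
  have hS3 : ∀ p ∈ S, (0:ℝ) ≤ p.2 + ‖p.1‖ ^ 2 / 2 := by
    intro p hp
    have := hlow p hp
    rw [WithLp.prod_norm_sq_eq_of_L2]
    have h2 := norm_add_sq_real p.1.fst p.1.snd
    nlinarith [sq_nonneg ‖p.1.fst + p.1.snd‖]
  obtain ⟨q, hqS, hq⟩ := exists_min_of_convex S ⟨_, hgr y₀ v₀ h₀⟩ hS1 hS2 hS3
  set a := q.1.fst with ha
  set b := q.1.snd with hb
  have hk : ∀ y v, v ∈ A y → ‖a + b‖ ^ 2 ≤ ⟪y + b, v + a⟫ := by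
    intro y v hv
    have h1 := hq _ (hgr y v hv)
    have h2 := hlow q hqS
    rw [WithLp.prod_norm_sq_eq_of_L2, WithLp.prod_inner_apply] at h1
    simp only [← ha, ← hb] at h1 h2
    rw [norm_add_sq_real]
    simp only [inner_add_left, inner_add_right]
    have e1 := real_inner_comm a y
    have e2 := real_inner_comm a b
    change q.2 + (‖a‖ ^ 2 + ‖b‖ ^ 2) ≤ ⟪y, v⟫ + (⟪a, y⟫ + ⟪b, v⟫) at h1
    linarith
  have hm : -a ∈ A (-b) := by
    refine hA.2 _ _ fun y v hv => ?_
    have h1 := hk y v hv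
    have : ⟪-b - y, -a - v⟫ = ⟪y + b, v + a⟫ := by
      rw [show -b - y = -(y + b) by abel, show -a - v = -(v + a) by abel, inner_neg_neg]
    rw [this]
    nlinarith [sq_nonneg ‖a + b‖]
  have h3 := hk _ _ hm
  simp only [neg_add_cancel, inner_zero_left] at h3
  have h4 : a + b = 0 := by
    rw [← norm_eq_zero]; nlinarith [norm_nonneg (a + b)]
  have h5 : -b = a := by rw [eq_comm, eq_neg_iff_add_eq_zero]; exact h4
  exact ⟨a, by rw [← h5] at hm ⊢; rw [h5] at hm ⊢; exact hm⟩

theorem MaxMonAux.exists_resolvent [CompleteSpace H] {A : H → Set H} (hA : MaxMonAux A)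
    {l : ℝ} (hl : 0 < l) (u : H) : ∃ p v : H, v ∈ A p ∧ u - p = l • v := by
  have : MaxMonAux (fun x => {w | ∃ v ∈ A x, w = l • v - u}) := by
    constructor
    · rintro x _ y _ ⟨p, hp, rfl⟩ ⟨q, hq, rfl⟩
      rw [sub_sub_sub_cancel_right, ← smul_sub, inner_smul_right]
      exact mul_nonneg hl.le (hA.1 hp hq)
    · intro x w h
      refine ⟨l⁻¹ • (w + u), hA.2 _ _ fun y v hv => ?_, ?_⟩
      · have h1 := h y _ ⟨v, hv, rfl⟩
        have : w - (l • v - u) = l • (l⁻¹ • (w + u) - v) := by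
          rw [smul_sub, smul_inv_smul₀ hl.ne']; abel
        rw [this, inner_smul_right] at h1
        exact nonneg_of_mul_nonneg_right h1 hl
      · rw [smul_inv_smul₀ hl.ne']; abel
  obtain ⟨a, v, hv, h⟩ := this.exists_neg_mem
  exact ⟨a, v, hv, by rw [sub_eq_add_neg, h]; abel⟩

theorem ode_integral_bound {E : Type*} [NormedAddCommGroup E] [NormedSpace ℝ E]
    {c w : ℝ → ℝ} (hc : Continuous c) (hw : ∀ t, HasDerivAt w (c t) t) (hw0 : w 0 = 0)
    {f : ℝ → E} {K t : ℝ} (hK : 0 ≤ K) (ht : 0 ≤ t)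
    (hf : ∀ s, 0 ≤ s → ‖f s‖ ≤ K * (Real.exp (w s) * c s)) :
    ‖∫ s in (0:ℝ)..t, f s‖ ≤ K * Real.exp (w t) := by
  have hwc : Continuous w := continuous_iff_continuousAt.2 fun t => (hw t).continuousAt
  have h1 : ∫ s in (0:ℝ)..t, K * (Real.exp (w s) * c s) = K * Real.exp (w t) - K * Real.exp (w 0) :=
    intervalIntegral.integral_eq_sub_of_hasDerivAt (f := fun s => K * Real.exp (w s))
      (fun s _ => ((hw s).exp).const_mul K)
      (Continuous.intervalIntegrable (by fun_prop) _ _)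
  have h2 : ‖∫ s in (0:ℝ)..t, f s‖ ≤ ∫ s in (0:ℝ)..t, K * (Real.exp (w s) * c s) := by
    refine intervalIntegral.norm_integral_le_of_norm_le ht ?_
      (Continuous.intervalIntegrable (by fun_prop) _ _)
    exact Eventually.of_forall fun s hs => hf s hs.1.le
  rw [h1, hw0, Real.exp_zero] at h2
  linarith

/-- Global existence for an ODE with right-hand side Lipschitz in space. -/
theorem ode_global_exists {E : Type*} [NormedAddCommGroup E] [NormedSpace ℝ E] [CompleteSpace E]
    (F : ℝ → E → E) (L : ℝ → ℝ) (hL : Continuous L) (hL0 : ∀ t, 0 ≤ L t)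
    (hLip : ∀ t x y, ‖F t x - F t y‖ ≤ L t * ‖x - y‖)
    (hF : ∀ u : ℝ → E, Continuous u → Continuous fun t => F t (u t)) (x₀ : E) :
    ∃ x v : ℝ → E, x 0 = x₀ ∧ Continuous v ∧ (∀ t, HasDerivAt x (v t) t) ∧
      ∀ t, 0 ≤ t → v t = F t (x t) := by
  set c : ℝ → ℝ := fun s => 2 * L s + ‖F s 0‖ with hcdef
  have hc : Continuous c := by
    have := hF (fun _ => 0) continuous_const
    fun_prop
  have hc0 : ∀ t, 0 ≤ c t := fun t => by have := hL0 t; positivity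
  set w : ℝ → ℝ := fun t => ∫ s in (0:ℝ)..t, c s with hwdef
  have hw : ∀ t, HasDerivAt w (c t) t := fun t => (hc.integral_hasStrictDerivAt 0 t).hasDerivAt
  have hwc : Continuous w := continuous_iff_continuousAt.2 fun t => (hw t).continuousAt
  have hw0 : w 0 = 0 := by simp [hwdef]
  have hwn : ∀ t, 0 ≤ t → 0 ≤ w t := fun t ht =>
    intervalIntegral.integral_nonneg ht fun s _ => hc0 s
  let f : BoundedContinuousFunction ℝ E → ℝ → E := fun z s => F s (Real.exp (w s) • z s)
  have hf : ∀ z, Continuous (f z) := fun z => hF _ (by fun_prop)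
  let I : BoundedContinuousFunction ℝ E → ℝ → E := fun z t => ∫ s in (0:ℝ)..t, f z s
  have hI : ∀ z t, HasDerivAt (I z) (f z t) t := fun z t =>
    ((hf z).integral_hasStrictDerivAt 0 t).hasDerivAt
  have hIc : ∀ z, Continuous (I z) := fun z =>
    continuous_iff_continuousAt.2 fun t => (hI z t).continuousAt
  have hfb : ∀ z s, 0 ≤ s → ‖f z s‖ ≤ (1 + ‖z‖) * (Real.exp (w s) * c s) := by
    intro z s hs
    have h1 := hLip s (Real.exp (w s) • z s) 0
    rw [sub_zero, norm_smul, Real.norm_of_nonneg (Real.exp_pos _).le] at h1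
    have h2 : ‖f z s‖ ≤ ‖F s (Real.exp (w s) • z s) - F s 0‖ + ‖F s 0‖ :=
      norm_le_norm_sub_add _ _
    have h3 : 1 ≤ Real.exp (w s) := Real.one_le_exp (hwn s hs)
    have h4 := z.norm_coe_le_norm s
    have h5 : L s * (Real.exp (w s) * ‖z s‖) ≤ c s * (Real.exp (w s) * ‖z‖) := by
      have := hL0 s
      have : L s ≤ c s := by simp only [hcdef]; linarith [norm_nonneg (F s 0)]
      gcongr
    have h6 : ‖F s 0‖ ≤ Real.exp (w s) * c s := by
      have : ‖F s 0‖ ≤ c s := by simp only [hcdef]; linarith [hL0 s]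
      nlinarith [hc0 s]
    nlinarith
  have hfd : ∀ z z' s, 0 ≤ s → ‖f z s - f z' s‖ ≤ (‖z - z'‖ / 2) * (Real.exp (w s) * c s) := by
    intro z z' s hs
    have h1 := hLip s (Real.exp (w s) • z s) (Real.exp (w s) • z' s)
    rw [← smul_sub, norm_smul, Real.norm_of_nonneg (Real.exp_pos _).le] at h1
    have h4 := (z - z').norm_coe_le_norm s
    rw [BoundedContinuousFunction.sub_apply] at h4
    have h5 : L s * (Real.exp (w s) * ‖z s - z' s‖) ≤ (c s / 2) * (Real.exp (w s) * ‖z - z'‖) := by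
      have := hL0 s
      have : L s ≤ c s / 2 := by simp only [hcdef]; linarith [norm_nonneg (F s 0)]
      gcongr
    calc _ ≤ _ := h1.trans h5
      _ = _ := by ring
  have hIb : ∀ z t, 0 ≤ t → ‖I z t‖ ≤ (1 + ‖z‖) * Real.exp (w t) := fun z t ht =>
    ode_integral_bound hc hw hw0 (by positivity) ht (hfb z)
  have hId : ∀ z z' t, 0 ≤ t → ‖I z t - I z' t‖ ≤ (‖z - z'‖ / 2) * Real.exp (w t) := by
    intro z z' t ht
    have : I z t - I z' t = ∫ s in (0:ℝ)..t, (f z s - f z' s) :=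
      (intervalIntegral.integral_sub ((hf z).intervalIntegrable _ _)
        ((hf z').intervalIntegrable _ _)).symm
    rw [this]
    exact ode_integral_bound hc hw hw0 (by positivity) ht (hfd z z')
  let Ψ : BoundedContinuousFunction ℝ E → BoundedContinuousFunction ℝ E := fun z =>
    BoundedContinuousFunction.ofNormedAddCommGroup
      (fun t => Real.exp (-w (max t 0)) • (x₀ + I z (max t 0)))
      (by have := hIc z; fun_prop) (‖x₀‖ + (1 + ‖z‖)) (by
        intro t
        have h0 : 0 ≤ max t 0 := le_max_right _ _
        set τ := max t 0
        rw [norm_smul, Real.norm_of_nonneg (Real.exp_pos _).le]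
        have h1 := hIb z τ h0
        have h2 : ‖x₀ + I z τ‖ ≤ ‖x₀‖ + ‖I z τ‖ := norm_add_le _ _
        have h3 : 1 ≤ Real.exp (w τ) := Real.one_le_exp (hwn τ h0)
        rw [Real.exp_neg, inv_mul_le_iff₀ (Real.exp_pos _)]
        nlinarith [norm_nonneg x₀])
  have hΨ : ContractingWith (1 / 2) Ψ := by
    refine ⟨by rw [div_lt_one] <;> norm_num, LipschitzWith.of_dist_le_mul fun z z' => ?_⟩
    rw [BoundedContinuousFunction.dist_le (by positivity)]
    intro t
    have h0 : 0 ≤ max t 0 := le_max_right _ _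
    change dist (Real.exp (-w (max t 0)) • (x₀ + I z (max t 0)))
      (Real.exp (-w (max t 0)) • (x₀ + I z' (max t 0))) ≤ _
    set τ := max t 0
    rw [dist_eq_norm, ← smul_sub, add_sub_add_left_eq_sub, norm_smul,
      Real.norm_of_nonneg (Real.exp_pos _).le, Real.exp_neg, inv_mul_le_iff₀ (Real.exp_pos _)]
    refine (hId z z' τ h0).trans (le_of_eq ?_)
    rw [dist_eq_norm]; push_cast; ring
  set z := ContractingWith.fixedPoint Ψ hΨ
  have hz : Ψ z = z := hΨ.fixedPoint_isFixedPt
  refine ⟨fun t => x₀ + I z t, f z, by simp [I], hf z, fun t => (hI z t).const_add x₀, ?_⟩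
  intro t ht
  have h1 : z t = Real.exp (-w t) • (x₀ + I z t) := by
    conv_lhs => rw [← hz]
    change Real.exp (-w (max t 0)) • (x₀ + I z (max t 0)) = _
    rw [max_eq_left ht]
  change F t (Real.exp (w t) • z t) = _
  rw [h1, smul_smul, ← Real.exp_add, add_neg_cancel, Real.exp_zero, one_smul]

theorem AbsolutelyContinuousOnIcc.toInterval {f : ℝ → H} {b : ℝ} (hb : 0 < b)
    (hf : AbsolutelyContinuousOnIcc f b) : AbsolutelyContinuousOnInterval f 0 b := by
  rw [absolutelyContinuousOnInterval_iff]
  intro ε hε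
  obtain ⟨δ, hδ, h⟩ := hf ε hε
  refine ⟨δ, hδ, ?_⟩
  rintro ⟨n, I⟩ ⟨hI1, hI2⟩ hs
  simp only at hI1 hI2 hs ⊢
  rw [Set.uIcc_of_le hb.le] at hI1
  have key := h n (fun k => min (I k).1 (I k).2) (fun k => max (I k).1 (I k).2) ?_ ?_ ?_
  · rw [← Fin.sum_univ_eq_sum_range (fun i => dist (f (I i).1) (f (I i).2))]
    refine lt_of_le_of_lt (le_of_eq (Finset.sum_congr rfl fun k _ => ?_)) key
    rcases le_total (I k).1 (I k).2 with hk | hk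
    · rw [min_eq_left hk, max_eq_right hk, dist_comm, dist_eq_norm]
    · rw [min_eq_right hk, max_eq_left hk, dist_eq_norm]
  · intro k
    obtain ⟨⟨h1, h2⟩, h3, h4⟩ := hI1 k (by simp)
    exact ⟨le_min h1 h3, min_le_max, max_le h2 h4⟩
  · intro i j hij
    have := hI2 (x := (i:ℕ)) (by simp) (y := (j:ℕ)) (by simp) (fun h => hij (Fin.ext h))
    exact Disjoint.mono Set.Ioo_subset_Ioc_self Set.Ioo_subset_Ioc_self this
  · rw [← Fin.sum_univ_eq_sum_range (fun i => dist (I i).1 (I i).2)] at hs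
    refine lt_of_le_of_lt (le_of_eq (Finset.sum_congr rfl fun k _ => ?_)) hs
    rw [Real.dist_eq, max_sub_min_eq_abs, abs_sub_comm]

theorem ac_norm {f : ℝ → H} {a b : ℝ} (hf : AbsolutelyContinuousOnInterval f a b) :
    AbsolutelyContinuousOnInterval (fun t => ‖f t‖) a b := by
  rw [absolutelyContinuousOnInterval_iff] at hf ⊢
  intro ε hε
  obtain ⟨δ, hδ, h⟩ := hf ε hε
  refine ⟨δ, hδ, fun E hE hs => lt_of_le_of_lt (Finset.sum_le_sum fun i _ => ?_) (h E hE hs)⟩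
  rw [dist_eq_norm (f (E.2 i).1)]
  exact dist_norm_norm_le (f (E.2 i).1) (f (E.2 i).2)

theorem ode_unique {x y xd yd : ℝ → H} {b K : ℝ} (hb : 0 < b)
    (hx : AbsolutelyContinuousOnInterval x 0 b) (hy : AbsolutelyContinuousOnInterval y 0 b)
    (h0 : x 0 = y 0)
    (hd : ∀ᵐ t ∂(volume.restrict (Set.Icc 0 b)), HasDerivAt x (xd t) t ∧ HasDerivAt y (yd t) t ∧
      ‖xd t - yd t‖ ≤ K * ‖x t - y t‖) : x b = y b := by
  set n : ℝ → ℝ := fun t => ‖x t - y t‖ with hn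
  have hnac : AbsolutelyContinuousOnInterval n 0 b := ac_norm (hx.sub hy)
  have heac : AbsolutelyContinuousOnInterval (fun t : ℝ => Real.exp (-(2 * K) * t)) 0 b :=
    ContDiffOn.absolutelyContinuousOnInterval (by fun_prop)
  set g : ℝ → ℝ := (n * n) * (fun t : ℝ => Real.exp (-(2 * K) * t)) with hg
  have hgac : AbsolutelyContinuousOnInterval g 0 b := (hnac.mul hnac).mul heac
  have h1 := hgac.integral_deriv_eq_sub
  have h2 : 0 ≤ ∫ t in (0:ℝ)..b, -deriv g t := by
    refine intervalIntegral.integral_nonneg_of_ae_restrict hb.le ?_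
    filter_upwards [hd] with t ⟨hxt, hyt, hle⟩
    have e : g = fun t => ‖x t - y t‖ ^ 2 * Real.exp (-(2 * K) * t) := by
      ext t; simp only [hg, hn, Pi.mul_apply]; ring
    have hg' := ((hxt.sub hyt).norm_sq).mul ((((hasDerivAt_id t).const_mul (-(2 * K)))).exp)
    replace hg' : HasDerivAt g _ t := hg'.congr_of_eventuallyEq
      (Eventually.of_forall fun s => by rw [e]; rfl)
    rw [hg'.deriv]
    have h3 := real_inner_le_norm (x t - y t) (xd t - yd t)
    have h4 : ‖x t - y t‖ * ‖xd t - yd t‖ ≤ K * ‖x t - y t‖ ^ 2 := by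
      nlinarith [norm_nonneg (x t - y t)]
    have h5 : ⟪x t - y t, xd t - yd t⟫ - K * ‖x t - y t‖ ^ 2 ≤ 0 := by linarith
    have h6 := mul_nonneg_of_nonpos_of_nonpos h5
      (neg_nonpos.2 (Real.exp_pos (-(2 * K) * t)).le)
    simp only [Pi.zero_apply, id, Pi.sub_apply, mul_one]
    linarith
  rw [intervalIntegral.integral_neg, h1] at h2
  have hg0 : g 0 = 0 := by simp [hg, hn, h0]
  have hgb : n b * n b * Real.exp (-(2 * K) * b) ≤ 0 := by
    have : g b = n b * n b * Real.exp (-(2 * K) * b) := rfl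
    linarith
  have : n b * n b ≤ 0 := nonpos_of_mul_nonpos_left hgb (Real.exp_pos _)
  have h7 : n b = 0 := by nlinarith [mul_self_nonneg (n b)]
  exact sub_eq_zero.1 (norm_eq_zero.1 h7)

theorem ac_of_continuous_deriv {x v : ℝ → H} (hv : Continuous v)
    (hx : ∀ t, HasDerivAt x (v t) t) {b : ℝ} (hb : 0 < b) : AbsolutelyContinuousOnIcc x b := by
  obtain ⟨M, hM⟩ := isCompact_Icc.exists_bound_of_continuousOn (s := Set.Icc 0 b) hv.continuousOn
  have hM0 : 0 ≤ M := (norm_nonneg _).trans (hM 0 ⟨le_rfl, hb.le⟩)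
  intro ε hε
  refine ⟨ε / (M + 1), by positivity, fun n a c hac _ hs => ?_⟩
  have h1 : ∀ k, ‖x (c k) - x (a k)‖ ≤ M * (c k - a k) := by
    intro k
    obtain ⟨h1, h2, h3⟩ := hac k
    have := (convex_Icc 0 b).norm_image_sub_le_of_norm_hasDerivWithin_le
      (fun t _ => (hx t).hasDerivWithinAt) hM
      (⟨h1, h2.trans h3⟩ : a k ∈ Set.Icc 0 b) (⟨h1.trans h2, h3⟩ : c k ∈ Set.Icc 0 b)
    rwa [Real.norm_of_nonneg (by linarith)] at this
  have h2 : 0 ≤ ∑ k, (c k - a k) := Finset.sum_nonneg fun k _ => by linarith [(hac k).2.1]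
  calc ∑ k, ‖x (c k) - x (a k)‖ ≤ ∑ k, M * (c k - a k) := Finset.sum_le_sum fun k _ => h1 k
    _ = M * ∑ k, (c k - a k) := (Finset.mul_sum _ _ _).symm
    _ ≤ (M + 1) * ∑ k, (c k - a k) := by nlinarith
    _ < ε := by rwa [lt_div_iff₀' (by positivity)] at hs

theorem resolvent_ineq {A : H → Set H} (hA : MonotoneOperator A) {l m : ℝ} (hl : 0 < l)
    (hm : 0 < m) {u v p q a b : H} (ha : a ∈ A p) (hb : b ∈ A q) (hp : u - p = l • a)
    (hq : v - q = m • b) : ‖p - q‖ ≤ ‖(u - v) + (1 - l / m) • (v - q)‖ := by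
  have h1 := mul_nonneg hl.le (hA ha hb)
  rw [← inner_smul_right] at h1
  have h2 : l • (a - b) = ((u - v) + (1 - l / m) • (v - q)) - (p - q) := by
    have : l • b = (l / m) • (v - q) := by rw [hq, smul_smul, div_mul_cancel₀ _ hm.ne']
    rw [smul_sub, ← hp, this, sub_smul, one_smul]; abel
  rw [h2, inner_sub_right, real_inner_self_eq_norm_sq] at h1
  have h3 := real_inner_le_norm (p - q) ((u - v) + (1 - l / m) • (v - q))
  by_contra! h
  have : 0 < ‖p - q‖ := (norm_nonneg _).trans_lt h
  nlinarith

theorem Cocoercive.norm_le {γ : ℝ} (hγ : 0 < γ) {T : H → H} (hT : Cocoercive γ T) (x y : H) :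
    ‖T x - T y‖ ≤ γ⁻¹ * ‖x - y‖ := by
  have h1 := hT x y
  have h2 := real_inner_le_norm (x - y) (T x - T y)
  rw [le_inv_mul_iff₀ hγ]
  rcases (norm_nonneg (T x - T y)).eq_or_lt with h | h
  · rw [← h]; simp
  · nlinarith

/-- under (H1), for every initial point `x₀` there exists a unique strong global
solution of the dynamical system. -/
theorem existence_uniqueness_strong_global_solution [CompleteSpace H]
    (A : H → Set H) (hA : MaximallyMonotone A)
    (η μ : ℝ) (hη : 0 < η) (hμ : 0 < μ)
    (D B : H → H) (hD : Cocoercive η D) (hB : Cocoercive μ B)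
    (hC : {q : H | B q = 0}.Nonempty)
    (lam beta : ℝ → ℝ)
    (hlam_pos : ∀ t : ℝ, 0 ≤ t → 0 < lam t) (hbeta_pos : ∀ t : ℝ, 0 ≤ t → 0 < beta t)
    (hH1 : ∀ b > (0:ℝ), ContinuousOn lam (Set.Icc 0 b) ∧ ContinuousOn beta (Set.Icc 0 b))
    (x₀ : H) :
    ∃ x xd : ℝ → H, IsStrongGlobalSolution A D B lam beta x₀ x xd ∧
      ∀ y yd : ℝ → H, IsStrongGlobalSolution A D B lam beta x₀ y yd →
        ∀ t : ℝ, 0 ≤ t → y t = x t := by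

  have hA' := hA.aux
  have hex : ∀ (l : ℝ) (u : H), ∃ p : H, 0 < l → ∃ v ∈ A p, u - p = l • v := by
    intro l u
    by_cases hl : 0 < l
    · obtain ⟨p, v, hv, h⟩ := hA'.exists_resolvent hl u
      exact ⟨p, fun _ => ⟨v, hv, h⟩⟩
    · exact ⟨0, fun h => absurd h hl⟩
  choose J hJ using hex
  have hJc : ∀ (l : ℝ → ℝ) (u : ℝ → H), Continuous l → (∀ t, 0 < l t) → Continuous u →
      Continuous fun t => J (l t) (u t) := by
    intro l u hl hl0 hu
    rw [continuous_iff_continuousAt]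
    intro s
    rw [ContinuousAt, tendsto_iff_norm_sub_tendsto_zero]
    have hb : Tendsto (fun t => ‖(u t - u s) + (1 - l t / l s) • (u s - J (l s) (u s))‖) (nhds s)
        (nhds 0) := by
      have : Continuous (fun t => ‖(u t - u s) + (1 - l t / l s) • (u s - J (l s) (u s))‖) := by
        fun_prop
      have h := this.tendsto s
      simpa [div_self (hl0 s).ne'] using h
    refine squeeze_zero (fun t => norm_nonneg _) (fun t => ?_) hb
    obtain ⟨a, ha, ha'⟩ := hJ (l t) (u t) (hl0 t)
    obtain ⟨b, hb, hb'⟩ := hJ (l s) (u s) (hl0 s)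
    exact resolvent_ineq hA.1 (hl0 t) (hl0 s) ha hb ha' hb'
  have hext : ∀ k : ℝ → ℝ, (∀ b > (0:ℝ), ContinuousOn k (Set.Icc 0 b)) →
      Continuous fun t => k (max t 0) := by
    intro k hk
    rw [continuous_iff_continuousAt]
    intro s
    have h1 := hk (max s 0 + 1) (by linarith [le_max_right s 0])
    have h2 : ContinuousOn (fun t : ℝ => k (max t 0)) (Set.Iic (max s 0 + 1)) := by
      refine h1.comp (by fun_prop) fun t ht => ⟨le_max_right _ _, max_le ht ?_⟩
      linarith [le_max_right s 0]
    exact h2.continuousAt (Iic_mem_nhds (by linarith [le_max_left s 0]))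
  set l : ℝ → ℝ := fun t => lam (max t 0) with hldef
  set be : ℝ → ℝ := fun t => beta (max t 0) with hbedef
  have hlc : Continuous l := hext lam fun b hb => (hH1 b hb).1
  have hbc : Continuous be := hext beta fun b hb => (hH1 b hb).2
  have hl0 : ∀ t, 0 < l t := fun t => hlam_pos _ (le_max_right _ _)
  have hb0 : ∀ t, 0 < be t := fun t => hbeta_pos _ (le_max_right _ _)
  have hDl := hD.norm_le hη
  have hBl := hB.norm_le hμ
  have hcont : ∀ (T : H → H) (K : ℝ), 0 < K → (∀ x y, ‖T x - T y‖ ≤ K * ‖x - y‖) →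
      Continuous T := by
    intro T K hK hT
    exact (LipschitzWith.of_dist_le_mul (K := ⟨K, hK.le⟩) fun x y => by
      rw [dist_eq_norm, dist_eq_norm]; exact hT x y).continuous
  have hDc := hcont D _ (inv_pos.2 hη) hDl
  have hBc := hcont B _ (inv_pos.2 hμ) hBl
  let G : ℝ → H → H := fun t x => x - l t • D x - (l t * be t) • B x
  let F : ℝ → H → H := fun t x => J (l t) (G t x) - x
  let L : ℝ → ℝ := fun t => 2 + l t * η⁻¹ + (l t * be t) * μ⁻¹
  have hLc : Continuous L := by fun_prop
  have hL0 : ∀ t, 0 ≤ L t := fun t => by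
    have := hl0 t; have := hb0 t
    simp only [L]; positivity
  have hLip : ∀ t x y, ‖F t x - F t y‖ ≤ L t * ‖x - y‖ := by
    intro t x y
    obtain ⟨a, ha, ha'⟩ := hJ (l t) (G t x) (hl0 t)
    obtain ⟨b, hb, hb'⟩ := hJ (l t) (G t y) (hl0 t)
    have h1 := resolvent_ineq hA.1 (hl0 t) (hl0 t) ha hb ha' hb'
    rw [div_self (hl0 t).ne', sub_self, zero_smul, add_zero] at h1
    have h2 : G t x - G t y
        = (x - y) - l t • (D x - D y) - (l t * be t) • (B x - B y) := by
      simp only [G, smul_sub]; abel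
    have h3 : F t x - F t y = (J (l t) (G t x) - J (l t) (G t y)) - (x - y) := by
      simp only [F]; abel
    have h4 : ‖F t x - F t y‖ ≤ ‖J (l t) (G t x) - J (l t) (G t y)‖ + ‖x - y‖ := by
      rw [h3]; exact norm_sub_le _ _
    have h5 : ‖G t x - G t y‖ ≤ ‖x - y‖ + l t * ‖D x - D y‖ + (l t * be t) * ‖B x - B y‖ := by
      rw [h2]
      refine (norm_sub_le _ _).trans ?_
      rw [norm_smul (l t * be t), Real.norm_of_nonneg (mul_pos (hl0 t) (hb0 t)).le]
      refine add_le_add_left ((norm_sub_le _ _).trans ?_) _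
      rw [norm_smul, Real.norm_of_nonneg (hl0 t).le]
    have h6 := mul_le_mul_of_nonneg_left (hDl x y) (hl0 t).le
    have h7 := mul_le_mul_of_nonneg_left (hBl x y) (mul_pos (hl0 t) (hb0 t)).le
    simp only [L]
    linarith
  have hFc : ∀ u : ℝ → H, Continuous u → Continuous fun t => F t (u t) := by
    intro u hu
    exact (hJc l (fun t => G t (u t)) hlc hl0 (by simp only [G]; fun_prop)).sub hu
  obtain ⟨x, v, hx0, hvc, hxd, hxF⟩ := ode_global_exists F L hLc hL0 hLip hFc x₀
  have hsol : ∀ b > (0:ℝ), AbsolutelyContinuousOnIcc x b := fun b hb =>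
    ac_of_continuous_deriv hvc hxd hb
  refine ⟨x, v, ⟨hsol, hx0, ?_⟩, ?_⟩
  · filter_upwards [ae_restrict_mem measurableSet_Ici] with t ht
    have ht : 0 ≤ t := ht
    refine ⟨hxd t, ?_⟩
    have h1 : v t + x t = J (l t) (G t (x t)) := by rw [hxF t ht]; simp only [F]; abel
    have h2 : lam t = l t := by simp only [hldef, max_eq_left ht]
    have h3 : beta t = be t := by simp only [hbedef, max_eq_left ht]
    obtain ⟨a, ha, ha'⟩ := hJ (l t) (G t (x t)) (hl0 t)
    rw [h1, h2, h3]
    exact Set.mem_smul_set.2 ⟨a, ha, ha'.symm⟩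
  · rintro y yd ⟨hyac, hy0, hyd⟩ b hb
    rcases hb.eq_or_lt with rfl | hb
    · rw [hy0, hx0]
    obtain ⟨K, hK⟩ := isCompact_Icc.exists_bound_of_continuousOn (s := Set.Icc 0 b)
      hLc.continuousOn
    refine ode_unique (xd := yd) (yd := v) (K := K) hb ((hyac b hb).toInterval hb)
      ((hsol b hb).toInterval hb) (hy0.trans hx0.symm) ?_
    have hyd' := ae_restrict_of_ae_restrict_of_subset
      (Set.Icc_subset_Ici_self : Set.Icc 0 b ⊆ Set.Ici 0) hyd
    filter_upwards [hyd', ae_restrict_mem measurableSet_Icc] with t ⟨h1, h2⟩ ht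
    refine ⟨h1, hxd t, ?_⟩
    have hl : lam t = l t := by simp only [hldef, max_eq_left ht.1]
    have hbe : beta t = be t := by simp only [hbedef, max_eq_left ht.1]
    rw [hl, hbe] at h2
    obtain ⟨a, ha, ha'⟩ := Set.mem_smul_set.1 h2
    obtain ⟨c, hc, hc'⟩ := hJ (l t) (G t (y t)) (hl0 t)
    have h3 := resolvent_ineq hA.1 (hl0 t) (hl0 t) ha hc ha'.symm hc'
    rw [div_self (hl0 t).ne', sub_self (1:ℝ), zero_smul, add_zero] at h3
    have h4 : yd t + y t = J (l t) (G t (y t)) := by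
      rw [← sub_eq_zero, ← norm_le_zero_iff]
      refine h3.trans ?_
      simp [G]
    have h5 : yd t = F t (y t) := by simp only [F]; rw [← h4]; abel
    rw [h5, hxF t ht.1]
    refine (hLip t _ _).trans ?_
    have := (le_abs_self _).trans (hK t ht)
    gcongr
end

section
/- Assume (H1), (H2), (H3), (H_fitz), suppose limsup_{t→∞} λ(t)β(t) < 2μ, and let x be a strong global solution of the dynamical system. Then for every z ∈ zer(A + D + N_C): (a) ‖x(t) − z‖ converges as t → ∞; (b) ∫₀^∞ ‖ẋ(t)‖² dt < ∞; (c) ∫₀^∞ λ(t)β(t) ⟨B x(t), x(t) − z⟩ dt < ∞; (d) ∫₀^∞ λ(t)β(t) ‖B x(t)‖² dt < ∞. -/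
open scoped RealInnerProductSpace Pointwise
open MeasureTheory Filter

variable {H : Type*} [NormedAddCommGroup H] [InnerProductSpace ℝ H]

section Helpers

variable {H : Type*} [NormedAddCommGroup H] [InnerProductSpace ℝ H]

lemma aux_ac {x : ℝ → H} {b : ℝ} (hb : 0 ≤ b) (h : AbsolutelyContinuousOnIcc x b) :
    AbsolutelyContinuousOnInterval x 0 b := by
  rw [absolutelyContinuousOnInterval_iff]
  intro ε hε
  obtain ⟨δ, hδ, hh⟩ := h ε hε
  refine ⟨δ, hδ, ?_⟩
  rintro ⟨n, I⟩ hE hsum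
  obtain ⟨h1, h2⟩ := hE
  simp only [Finset.mem_range, Set.uIcc_of_le hb, Set.mem_Icc] at h1
  have key := hh n (fun k => min (I k).1 (I k).2) (fun k => max (I k).1 (I k).2) ?_ ?_ ?_
  · rw [← Fin.sum_univ_eq_sum_range (fun i => dist (x (I i).1) (x (I i).2)) n]
    refine lt_of_le_of_lt (le_of_eq ?_) key
    refine Finset.sum_congr rfl fun k _ => ?_
    rcases le_total (I k).1 (I k).2 with hk | hk
    · simp only [min_eq_left hk, max_eq_right hk]
      rw [dist_comm, dist_eq_norm]
    · simp only [min_eq_right hk, max_eq_left hk]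
      rw [dist_eq_norm]
  · intro k
    have := h1 k k.2
    refine ⟨le_min this.1.1 this.2.1, min_le_max, max_le this.1.2 this.2.2⟩
  · intro i j hij
    have := h2 (x := (i : ℕ)) (by simp) (y := (j : ℕ)) (by simp)
      (fun hc => hij (Fin.ext hc))
    exact this.mono Set.Ioo_subset_Ioc_self Set.Ioo_subset_Ioc_self
  · rw [← Fin.sum_univ_eq_sum_range (fun i => dist (I i).1 (I i).2) n] at hsum
    refine lt_of_le_of_lt (le_of_eq ?_) hsum
    refine Finset.sum_congr rfl fun k _ => ?_
    rw [Real.dist_eq, abs_sub_comm, max_sub_min_eq_abs]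

lemma aux_ac_norm {f : ℝ → H} {a b : ℝ} (hf : AbsolutelyContinuousOnInterval f a b) (z : H) :
    AbsolutelyContinuousOnInterval (fun t => ‖f t - z‖) a b := by
  refine squeeze_zero (fun t ↦ ?_) (fun t ↦ ?_) hf
  · exact Finset.sum_nonneg (fun i hi ↦ by positivity)
  · gcongr with i hi
    rw [Real.dist_eq, dist_eq_norm]
    refine (abs_norm_sub_norm_le _ _).trans (le_of_eq ?_)
    congr 1
    abel

lemma aux_ac_sq {f : ℝ → H} {a b : ℝ} (hf : AbsolutelyContinuousOnInterval f a b) (z : H) :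
    AbsolutelyContinuousOnInterval (fun t => ‖f t - z‖ ^ 2) a b := by
  have := (aux_ac_norm hf z).mul (aux_ac_norm hf z)
  convert this using 1
  ext t
  simp [sq]

lemma aux_scalar (h hd k g F : ℝ → ℝ)
    (hac : ∀ b, 0 ≤ b → AbsolutelyContinuousOnInterval h 0 b)
    (h0 : ∀ t, 0 ≤ h t) (k0 : ∀ t, 0 ≤ k t) (g0 : ∀ t, 0 ≤ g t)
    (F0 : ∀ t, 0 ≤ t → 0 ≤ F t)
    (hk : IntegrableOn k (Set.Ici 0)) (hg : IntegrableOn g (Set.Ici 0))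
    (hF : AEStronglyMeasurable F (volume.restrict (Set.Ici 0)))
    (hder : ∀ᵐ t ∂(volume.restrict (Set.Ici (0:ℝ))), HasDerivAt h (hd t) t ∧
      hd t + F t ≤ k t * h t + g t) :
    (∃ l, Tendsto h atTop (nhds l)) ∧ IntegrableOn F (Set.Ici 0) := by
  have hsub : ∀ s t : ℝ, 0 ≤ s → s ≤ t → Set.uIcc s t ⊆ Set.uIcc 0 t := by
    intro s t hs hst
    rw [Set.uIcc_of_le hst, Set.uIcc_of_le (hs.trans hst)]
    exact Set.Icc_subset_Icc_left hs
  have hacst : ∀ s t : ℝ, 0 ≤ s → s ≤ t → AbsolutelyContinuousOnInterval h s t :=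
    fun s t hs hst => (hac t (hs.trans hst)).mono (hsub s t hs hst)
  have hint : ∀ f : ℝ → ℝ, IntegrableOn f (Set.Ici 0) → ∀ s t : ℝ, 0 ≤ s → s ≤ t →
      IntervalIntegrable f volume s t := by
    intro f hf s t hs hst
    rw [intervalIntegrable_iff_integrableOn_Ioc_of_le hst]
    exact hf.mono_set (fun u hu => hs.trans hu.1.le)
  have hkh : ∀ s t : ℝ, 0 ≤ s → s ≤ t →
      IntervalIntegrable (fun u => k u * h u + g u) volume s t := by
    intro s t hs hst
    exact ((hint k hk s t hs hst).mul_continuousOn (hacst s t hs hst).continuousOn).add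
      (hint g hg s t hs hst)
  have hae : ∀ s t : ℝ, 0 ≤ s → ∀ᵐ u ∂(volume.restrict (Set.Icc s t)),
      0 ≤ F u ∧ deriv h u + F u ≤ k u * h u + g u := by
    intro s t hs
    have h1 : ∀ᵐ u ∂(volume.restrict (Set.Ici (0:ℝ))),
        0 ≤ F u ∧ deriv h u + F u ≤ k u * h u + g u := by
      filter_upwards [hder, ae_restrict_mem measurableSet_Ici] with u hu hu0
      exact ⟨F0 u hu0, by rw [hu.1.deriv]; exact hu.2⟩
    exact ae_restrict_of_ae_restrict_of_subset (fun u hu => hs.trans hu.1) h1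
  have stepA : ∀ s t : ℝ, 0 ≤ s → s ≤ t → h t - h s ≤ ∫ u in s..t, (k u * h u + g u) := by
    intro s t hs hst
    rw [← (hacst s t hs hst).integral_deriv_eq_sub]
    refine intervalIntegral.integral_mono_ae_restrict hst
      (hacst s t hs hst).intervalIntegrable_deriv (hkh s t hs hst) ?_
    filter_upwards [hae s t hs] with u hu
    linarith [hu.1, hu.2]
  -- choice of starting point
  have hkt : Tendsto (fun T => ∫ u in (0:ℝ)..T, k u) atTop (nhds (∫ u in Set.Ioi 0, k u)) :=
    intervalIntegral_tendsto_integral_Ioi 0 (hk.mono_set Set.Ioi_subset_Ici_self) tendsto_id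
  have hgle : ∀ f : ℝ → ℝ, (∀ t, 0 ≤ f t) → IntegrableOn f (Set.Ici 0) → ∀ s t : ℝ, 0 ≤ s →
      s ≤ t → ∫ u in s..t, f u ≤ ∫ u in Set.Ioi 0, f u := by
    intro f f0 hf s t hs hst
    rw [intervalIntegral.integral_of_le hst]
    refine setIntegral_mono_set (hf.mono_set Set.Ioi_subset_Ici_self) ?_ ?_
    · exact Eventually.of_forall f0
    · have hss : Set.Ioc s t ⊆ Set.Ioi 0 := fun u hu => lt_of_le_of_lt hs hu.1
      exact LE.le.eventuallyLE hss
  obtain ⟨T, hT0, hT⟩ : ∃ T : ℝ, 0 ≤ T ∧ (∫ u in Set.Ioi 0, k u) - 1/2 < ∫ u in (0:ℝ)..T, k u := by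
    have := (hkt.eventually (lt_mem_nhds (show (∫ u in Set.Ioi 0, k u) - 1/2 <
      ∫ u in Set.Ioi 0, k u by linarith))).and (eventually_ge_atTop 0)
    obtain ⟨T, hT⟩ := this.exists
    exact ⟨T, hT.2, hT.1⟩
  have hksmall : ∀ t, T ≤ t → ∫ u in T..t, k u ≤ 1/2 := by
    intro t ht
    have h1 := intervalIntegral.integral_add_adjacent_intervals
      (hint k hk 0 T le_rfl hT0) (hint k hk T t hT0 ht)
    have h2 := hgle k k0 hk 0 t le_rfl (hT0.trans ht)
    linarith
  set Ig := ∫ u in Set.Ioi 0, g u with hIg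
  have hb1 : ∀ t, T ≤ t → h t ≤ 2 * (h T + Ig) := by
    intro t ht
    obtain ⟨s, hs, hmax⟩ := isCompact_Icc.exists_isMaxOn (Set.nonempty_Icc.2 ht)
      ((hacst T t hT0 ht).continuousOn.mono (by rw [Set.uIcc_of_le ht]))
    have h1 := stepA T s hT0 hs.1
    have h2 : ∫ u in T..s, (k u * h u + g u) ≤ ∫ u in T..s, (k u * h s + g u) := by
      refine intervalIntegral.integral_mono_on hs.1 (hkh T s hT0 hs.1)
        (((hint k hk T s hT0 hs.1).mul_const _).add (hint g hg T s hT0 hs.1)) ?_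
      intro u hu
      have := hmax (show u ∈ Set.Icc T t from ⟨hu.1, hu.2.trans hs.2⟩)
      have := mul_le_mul_of_nonneg_left this (k0 u)
      simpa using this
    rw [intervalIntegral.integral_add ((hint k hk T s hT0 hs.1).mul_const _)
      (hint g hg T s hT0 hs.1), intervalIntegral.integral_mul_const] at h2
    have h3 := mul_le_mul_of_nonneg_right (hksmall s hs.1) (h0 s)
    have h4 := hgle g g0 hg T s hT0 hs.1
    have h5 : h t ≤ h s := hmax (Set.right_mem_Icc.2 ht)
    linarith
  obtain ⟨M, hM⟩ : ∃ M, ∀ t, 0 ≤ t → h t ≤ M := by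
    obtain ⟨C, hC⟩ := (hac T hT0).exists_bound
    refine ⟨max C (2 * (h T + Ig)), fun t ht => ?_⟩
    rcases le_total t T with htT | htT
    · have := hC t (by rw [Set.uIcc_of_le hT0]; exact ⟨ht, htT⟩)
      exact le_max_of_le_left ((le_abs_self _).trans this)
    · exact le_max_of_le_right (hb1 t htT)
  have hM0 : 0 ≤ M := (h0 0).trans (hM 0 le_rfl)
  let g2 : ℝ → ℝ := fun u => k u * M + g u
  have hg2 : IntegrableOn g2 (Set.Ici 0) := Integrable.add (Integrable.mul_const hk M) hg
  have g20 : ∀ t, 0 ≤ g2 t := fun t => add_nonneg (mul_nonneg (k0 t) hM0) (g0 t)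
  have hg2le : ∀ s t : ℝ, 0 ≤ s → s ≤ t →
      ∫ u in s..t, (k u * h u + g u) ≤ ∫ u in s..t, g2 u := by
    intro s t hs hst
    refine intervalIntegral.integral_mono_on hst (hkh s t hs hst) (hint g2 hg2 s t hs hst) ?_
    intro u hu
    have := mul_le_mul_of_nonneg_left (hM u (hs.trans hu.1)) (k0 u)
    simp only [g2]; linarith
  constructor
  · let q : ℝ → ℝ := fun t => h (max t 0) - ∫ u in (0:ℝ)..(max t 0), g2 u
    have hanti : Antitone q := by
      intro s t hst
      have hs0 : (0:ℝ) ≤ max s 0 := le_max_right _ _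
      have hst' : max s 0 ≤ max t 0 := max_le_max hst le_rfl
      have h1 := stepA _ _ hs0 hst'
      have h2 := hg2le _ _ hs0 hst'
      have h3 := intervalIntegral.integral_add_adjacent_intervals
        (hint g2 hg2 0 _ le_rfl hs0) (hint g2 hg2 _ _ hs0 hst')
      simp only [q]; linarith
    have hbdd : BddBelow (Set.range q) := by
      refine ⟨-∫ u in Set.Ioi 0, g2 u, ?_⟩
      rintro _ ⟨t, rfl⟩
      have h1 := hgle g2 g20 hg2 0 (max t 0) le_rfl (le_max_right _ _)
      have h2 := h0 (max t 0)
      simp only [q]; linarith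
    have hq := tendsto_atTop_ciInf hanti hbdd
    have hG : Tendsto (fun T => ∫ u in (0:ℝ)..T, g2 u) atTop (nhds (∫ u in Set.Ioi 0, g2 u)) :=
      intervalIntegral_tendsto_integral_Ioi 0 (hg2.mono_set Set.Ioi_subset_Ici_self) tendsto_id
    refine ⟨_, (hq.add hG).congr' ?_⟩
    filter_upwards [eventually_ge_atTop 0] with t ht
    simp only [q, max_eq_left ht]; ring
  · rw [integrableOn_Ici_iff_integrableOn_Ioi]
    have hFint : ∀ t, 0 ≤ t → IntervalIntegrable F volume 0 t := by
      intro t ht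
      refine ((hkh 0 t le_rfl ht).sub (hac t ht).intervalIntegrable_deriv).mono_fun ?_ ?_
      · rw [Set.uIoc_of_le ht]
        exact hF.mono_set (fun u hu => hu.1.le)
      · rw [Set.uIoc_of_le ht]
        have := ae_restrict_of_ae_restrict_of_subset Set.Ioc_subset_Icc_self (hae 0 t le_rfl)
        filter_upwards [this] with u hu
        rw [Real.norm_of_nonneg hu.1]
        refine le_trans ?_ (le_abs_self _)
        linarith [hu.2]
    refine integrableOn_Ioi_of_intervalIntegral_norm_bounded (h 0 + ∫ u in Set.Ioi 0, g2 u) 0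
      (l := atTop) (b := fun t => max t 0) ?_ ?_ ?_
    · intro t
      have := hFint (max t 0) (le_max_right _ _)
      rwa [intervalIntegrable_iff_integrableOn_Ioc_of_le (le_max_right _ _)] at this
    · exact tendsto_atTop_mono (fun t => le_max_left t 0) tendsto_id
    · filter_upwards [eventually_ge_atTop 0] with t ht
      rw [max_eq_left ht]
      have h1 : ∫ u in (0:ℝ)..t, ‖F u‖ ≤ ∫ u in (0:ℝ)..t, (k u * h u + g u - deriv h u) := by
        refine intervalIntegral.integral_mono_ae_restrict ht (hFint t ht).norm
          ((hkh 0 t le_rfl ht).sub (hac t ht).intervalIntegrable_deriv) ?_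
        filter_upwards [hae 0 t le_rfl] with u hu
        rw [Real.norm_of_nonneg hu.1]
        linarith [hu.2]
      rw [intervalIntegral.integral_sub (hkh 0 t le_rfl ht) (hac t ht).intervalIntegrable_deriv,
        (hac t ht).integral_deriv_eq_sub] at h1
      have h2 := hg2le 0 t le_rfl ht
      have h3 := hgle g2 g20 hg2 0 t le_rfl ht
      have h4 := h0 t
      linarith

lemma aux_ofReal_le {r : ℝ} {e : EReal} (h : (r : EReal) ≤ e) :
    ENNReal.ofReal r ≤ erealToENNReal e := by
  unfold erealToENNReal
  split_ifs with he
  · exact le_top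
  · have hb : e ≠ ⊥ := by
      rintro rfl
      simp at h
    refine ENNReal.ofReal_le_ofReal ?_
    rw [← EReal.coe_le_coe_iff, EReal.coe_toReal he hb]
    exact h

lemma aux_fitz (B : H → H) (z p y : H) (hp : p ∈ normalCone {q : H | B q = 0} z) (l b : ℝ)
    (hl : 0 < l) (hb : 0 < b) :
    ENNReal.ofReal (l * ⟪y - z, p⟫ - l * b * ⟪y - z, B y⟫) ≤
      ENNReal.ofReal (l * b) *
        erealToENNReal ((⨆ u ∈ {q : H | B q = 0}, fitzpatrick B u (b⁻¹ • p)) -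
          supportFn {q : H | B q = 0} (b⁻¹ • p)) := by
  have hsup : supportFn {q : H | B q = 0} (b⁻¹ • p) ≤ ((⟪z, b⁻¹ • p⟫ : ℝ) : EReal) := by
    unfold supportFn
    refine iSup₂_le fun y hy => ?_
    rw [EReal.coe_le_coe_iff, inner_smul_right, inner_smul_right]
    have := hp.2 y hy
    rw [inner_sub_left] at this
    exact mul_le_mul_of_nonneg_left (by linarith) (inv_nonneg.2 hb.le)
  have hf : ((⟪z, B y⟫ + ⟪y, b⁻¹ • p⟫ - ⟪y, B y⟫ : ℝ) : EReal) ≤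
      ⨆ u ∈ {q : H | B q = 0}, fitzpatrick B u (b⁻¹ • p) := by
    refine le_trans ?_ (le_iSup₂ (f := fun u (_ : u ∈ {q : H | B q = 0}) =>
      fitzpatrick B u (b⁻¹ • p)) z hp.1)
    unfold fitzpatrick
    exact le_iSup (fun y : H => ((⟪z, B y⟫ + ⟪y, b⁻¹ • p⟫ - ⟪y, B y⟫ : ℝ) : EReal)) y
  have h1 := EReal.sub_le_sub hf hsup
  rw [← EReal.coe_sub] at h1
  have h2 := aux_ofReal_le h1
  have : l * ⟪y - z, p⟫ - l * b * ⟪y - z, B y⟫ =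
      (l * b) * (⟪z, B y⟫ + ⟪y, b⁻¹ • p⟫ - ⟪y, B y⟫ - ⟪z, b⁻¹ • p⟫) := by
    simp only [inner_smul_right, inner_sub_left]
    field_simp
    ring
  rw [this, ENNReal.ofReal_mul (by positivity)]
  gcongr

lemma aux_lip {γ : ℝ} (hγ : 0 < γ) {T : H → H} (h : Cocoercive γ T) (x y : H) :
    ‖T x - T y‖ ≤ γ⁻¹ * ‖x - y‖ := by
  have h1 := h x y
  have h2 := real_inner_le_norm (x - y) (T x - T y)
  rcases (norm_nonneg (T x - T y)).eq_or_lt with h3 | h3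
  · rw [← h3]; positivity
  · rw [inv_mul_eq_div, le_div_iff₀ hγ]
    nlinarith

lemma aux_cont {γ : ℝ} (hγ : 0 < γ) {T : H → H} (h : Cocoercive γ T) : Continuous T := by
  refine (LipschitzWith.of_dist_le_mul (K := ⟨γ⁻¹, by positivity⟩) fun x y => ?_).continuous
  rw [dist_eq_norm, dist_eq_norm]
  exact aux_lip hγ h x y

lemma aux_young (c r : ℝ) (hc : 0 < c) (e d : H) :
    -(r * ⟪e, d⟫) ≤ c * ‖e‖ ^ 2 + r ^ 2 / (4 * c) * ‖d‖ ^ 2 := by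
  have h1 : 0 ≤ ‖(2 * c) • e + r • d‖ ^ 2 := by positivity
  rw [norm_add_sq_real, norm_smul, norm_smul, inner_smul_left, inner_smul_right, mul_pow, mul_pow,
    Real.norm_eq_abs, Real.norm_eq_abs, sq_abs, sq_abs] at h1
  simp only [conj_trivial] at h1
  have h2 : 4 * c * (c * ‖e‖ ^ 2 + r ^ 2 / (4 * c) * ‖d‖ ^ 2 + r * ⟪e, d⟫) =
    (2 * c) ^ 2 * ‖e‖ ^ 2 + 2 * (2 * c * (r * ⟪e, d⟫)) + r ^ 2 * ‖d‖ ^ 2 := by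
    field_simp
    ring
  rw [← h2] at h1
  have := nonneg_of_mul_nonneg_right h1 (by positivity)
  linarith

lemma aux_point {η μ l a R : ℝ} (hη : 0 < η) (hl : 0 < l) (ha : 0 < a)
    (w e d b p : H)
    (hmono : 0 ≤ ⟪e + w, -e - l • d - a • b + l • p⟫)
    (hd : 0 ≤ ⟪w, d⟫) (hdl : ‖d‖ ≤ η⁻¹ * ‖w‖) (hb : μ * ‖b‖ ^ 2 ≤ ⟪w, b⟫) (hb0 : 0 ≤ ⟪w, b⟫)
    (hR : a ≤ 2 * μ ∧ 0 ≤ R ∨ R = 2 / 3 * (a ^ 2 * ‖b‖ ^ 2)) :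
    2 * ⟪w, e⟫ + (1 / 4 * ‖e‖ ^ 2 + 1 / 3 * (a * ⟪b, w⟫)) ≤
      8 * (η⁻¹) ^ 2 * l ^ 2 * ‖w‖ ^ 2 + (8 * ‖p‖ ^ 2 * l ^ 2 +
        1 / 3 * max (l * ⟪w, (6:ℝ) • p⟫ - a * ⟪w, b⟫) 0 + R) := by
  have y1 := aux_young (1/16) l (by norm_num) e d
  have y2 := aux_young (1/16) (-l) (by norm_num) e p
  have y3 := aux_young (3/4) a (by norm_num) e b
  have hdd : ‖d‖ ^ 2 ≤ (η⁻¹) ^ 2 * ‖w‖ ^ 2 := by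
    rw [← mul_pow]; exact pow_le_pow_left₀ (norm_nonneg _) hdl 2
  have hdd' : l ^ 2 * ‖d‖ ^ 2 ≤ l ^ 2 * ((η⁻¹) ^ 2 * ‖w‖ ^ 2) :=
    mul_le_mul_of_nonneg_left hdd (sq_nonneg l)
  have hld : 0 ≤ l * ⟪w, d⟫ := mul_nonneg hl.le hd
  have hm := le_max_left (l * ⟪w, (6:ℝ) • p⟫ - a * ⟪w, b⟫) 0
  rw [inner_smul_right] at hm
  rw [inner_smul_right]
  have hRR : a ^ 2 * ‖b‖ ^ 2 / 3 ≤ 2 / 3 * (a * ⟪w, b⟫) + R / 2 := by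
    have hab : 0 ≤ a * ⟪w, b⟫ := mul_nonneg ha.le hb0
    rcases hR with ⟨h1, h2⟩ | h1
    · have h3 : a * (a * ‖b‖ ^ 2) ≤ a * (2 * μ * ‖b‖ ^ 2) := by gcongr
      have h4 := mul_le_mul_of_nonneg_left hb ha.le
      nlinarith
    · rw [h1]; linarith
  simp only [inner_add_left, inner_add_right, inner_sub_right, inner_neg_right, inner_smul_right,
    real_inner_self_eq_norm_sq] at hmono
  rw [real_inner_comm w b]
  generalize max (l * (6 * ⟪w, p⟫) - a * ⟪w, b⟫) 0 = m at *
  generalize η⁻¹ = k at *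
  have y1' : -(l * ⟪e, d⟫) ≤ 1 / 16 * ‖e‖ ^ 2 + 4 * (l ^ 2 * ‖d‖ ^ 2) := by
    rw [show l ^ 2 / (4 * (1 / 16)) = 4 * l ^ 2 by ring] at y1
    linarith
  have y2' : l * ⟪e, p⟫ ≤ 1 / 16 * ‖e‖ ^ 2 + 4 * (l ^ 2 * ‖p‖ ^ 2) := by
    rw [show (-l) ^ 2 / (4 * (1 / 16)) = 4 * l ^ 2 by ring] at y2
    linarith
  have y3' : -(a * ⟪e, b⟫) ≤ 3 / 4 * ‖e‖ ^ 2 + a ^ 2 * ‖b‖ ^ 2 / 3 := by linarith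
  linarith

lemma aux_toIci {Y : Type*} [TopologicalSpace Y] (f : ℝ → Y)
    (hf : ∀ b > (0:ℝ), ContinuousOn f (Set.Icc 0 b)) : ContinuousOn f (Set.Ici 0) := by
  intro t ht
  have ht' : (0:ℝ) ≤ t := ht
  have h1 := hf (t + 1) (by linarith) t ⟨ht', by linarith⟩
  refine h1.mono_of_mem_nhdsWithin ?_
  filter_upwards [self_mem_nhdsWithin, mem_nhdsWithin_of_mem_nhds (Iio_mem_nhds (lt_add_one t))]
    with u hu1 hu2
  exact ⟨hu1, le_of_lt hu2⟩

end Helpers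

/-- Theorem, part (i): convergence of `‖x(t) − z‖` and finiteness of the three
integrals, for every `z ∈ zer(A + D + N_C)`. -/
theorem main_theorem_part_i [CompleteSpace H]
    (A : H → Set H) (hA : MaximallyMonotone A)
    (η μ : ℝ) (hη : 0 < η) (hμ : 0 < μ)
    (D B : H → H) (hD : Cocoercive η D) (hB : Cocoercive μ B)
    (hC : {q : H | B q = 0}.Nonempty)
    (lam beta : ℝ → ℝ)
    (hlam_pos : ∀ t : ℝ, 0 ≤ t → 0 < lam t) (hbeta_pos : ∀ t : ℝ, 0 ≤ t → 0 < beta t)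
    (hH1 : ∀ b > (0:ℝ), ContinuousOn lam (Set.Icc 0 b) ∧ ContinuousOn beta (Set.Icc 0 b))
    (hH2 : MaximallyMonotone (fun q => A q + normalCone {q' : H | B q' = 0} q) ∧
      (zerSum A D {q : H | B q = 0}).Nonempty)
    (hH3 : IntegrableOn (fun t => lam t ^ 2) (Set.Ici (0:ℝ)) volume ∧
      ∫⁻ t in Set.Ici (0:ℝ), ENNReal.ofReal (lam t) = ⊤)
    (hfitz : ∀ p z : H, p ∈ normalCone {q : H | B q = 0} z →
      ∫⁻ t in Set.Ici (0:ℝ), ENNReal.ofReal (lam t * beta t) *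
        erealToENNReal ((⨆ u ∈ {q : H | B q = 0}, fitzpatrick B u ((beta t)⁻¹ • p)) -
          supportFn {q : H | B q = 0} ((beta t)⁻¹ • p)) < ⊤)
    (hls : limsup (fun t => ((lam t * beta t : ℝ) : EReal)) atTop < ((2 * μ : ℝ) : EReal))
    (x₀ : H) (x xd : ℝ → H)
    (hsol : IsStrongGlobalSolution A D B lam beta x₀ x xd)
    : ∀ z ∈ zerSum A D {q : H | B q = 0},
      (∃ l : ℝ, Tendsto (fun t => ‖x t - z‖) atTop (nhds l)) ∧
      IntegrableOn (fun t => ‖xd t‖ ^ 2) (Set.Ici (0:ℝ)) volume ∧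
      IntegrableOn (fun t => lam t * beta t * ⟪B (x t), x t - z⟫) (Set.Ici (0:ℝ)) volume ∧
      IntegrableOn (fun t => lam t * beta t * ‖B (x t)‖ ^ 2) (Set.Ici (0:ℝ)) volume := by
  rintro z ⟨v, hv, p, hp, hvp⟩
  obtain ⟨hxac, -, hxae⟩ := hsol
  have hac : ∀ b, 0 ≤ b → AbsolutelyContinuousOnInterval x 0 b := by
    intro b hb
    refine (aux_ac (b := b + 1) (by linarith) (hxac (b + 1) (by linarith))).mono ?_
    rw [Set.uIcc_of_le hb, Set.uIcc_of_le (by linarith)]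
    exact Set.Icc_subset_Icc_right (by linarith)
  have hBz : B z = 0 := hp.1
  have cx : ContinuousOn x (Set.Ici 0) := aux_toIci x fun b hb => by
    have := (hac b hb.le).continuousOn
    rwa [Set.uIcc_of_le hb.le] at this
  have cl : ContinuousOn lam (Set.Ici 0) := aux_toIci lam fun b hb => (hH1 b hb).1
  have cb : ContinuousOn beta (Set.Ici 0) := aux_toIci beta fun b hb => (hH1 b hb).2
  have cBx : ContinuousOn (fun t => B (x t)) (Set.Ici 0) :=
    (aux_cont hμ hB).comp_continuousOn cx
  have cw : ContinuousOn (fun t => x t - z) (Set.Ici 0) := cx.sub continuousOn_const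
  have hmonoB : ∀ y, μ * ‖B y‖ ^ 2 ≤ ⟪y - z, B y⟫ := by
    intro y
    have := hB y z
    rwa [hBz, sub_zero] at this
  have hmonoB0 : ∀ y, 0 ≤ ⟪y - z, B y⟫ := fun y =>
    le_trans (by positivity) (hmonoB y)
  -- eventual bound
  obtain ⟨T, hT⟩ : ∃ T : ℝ, ∀ t, T ≤ t → lam t * beta t ≤ 2 * μ := by
    have := eventually_lt_of_limsup_lt hls
    obtain ⟨T, hT⟩ := eventually_atTop.1 this
    exact ⟨T, fun t ht => le_of_lt (EReal.coe_lt_coe_iff.1 (hT t ht))⟩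
  -- Fitzpatrick term
  let G : ℝ → ℝ := fun t => lam t * ⟪x t - z, (6:ℝ) • p⟫ - lam t * beta t * ⟪x t - z, B (x t)⟫
  have cG : ContinuousOn G (Set.Ici 0) :=
    (cl.mul (cw.inner continuousOn_const)).sub ((cl.mul cb).mul (cw.inner cBx))
  have hp6 : (6:ℝ) • p ∈ normalCone {q : H | B q = 0} z := by
    refine ⟨hp.1, fun y hy => ?_⟩
    rw [inner_smul_right]
    have := hp.2 y hy
    linarith
  have hG : IntegrableOn (fun t => max (G t) 0) (Set.Ici 0) := by
    refine ⟨(cG.sup continuousOn_const).aestronglyMeasurable measurableSet_Ici, ?_⟩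
    rw [hasFiniteIntegral_iff_ofReal (f := fun t => max (G t) 0)
      (Eventually.of_forall fun t => le_max_right (G t) 0)]
    refine lt_of_le_of_lt (setLIntegral_mono' measurableSet_Ici fun t ht => ?_)
      (hfitz ((6:ℝ) • p) z hp6)
    have := aux_fitz B z ((6:ℝ) • p) (x t) hp6 (lam t) (beta t) (hlam_pos t ht) (hbeta_pos t ht)
    refine le_trans (le_of_eq ?_) this
    rw [ENNReal.ofReal_max]
    simp [G]
  -- compact remainder
  let r : ℝ → ℝ := fun t => 2 / 3 * ((lam t * beta t) ^ 2 * ‖B (x t)‖ ^ 2)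
  have cr : ContinuousOn r (Set.Ici 0) :=
    continuousOn_const.mul (((cl.mul cb).pow 2).mul (cBx.norm.pow 2))
  let R : ℝ → ℝ := (Set.Icc 0 T).indicator r
  have hR : IntegrableOn R (Set.Ici 0) := by
    have h1 : IntegrableOn r (Set.Icc 0 T) :=
      (cr.mono Set.Icc_subset_Ici_self).integrableOn_compact isCompact_Icc
    exact ((integrable_indicator_iff measurableSet_Icc).2 h1).integrableOn
  have hR0 : ∀ t, 0 ≤ R t := fun t => Set.indicator_nonneg (fun t _ => by positivity) t
  let F : ℝ → ℝ := fun t => 1 / 4 * ‖xd t‖ ^ 2 + 1 / 3 * (lam t * beta t * ⟪B (x t), x t - z⟫)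
  have mxd : AEStronglyMeasurable xd (volume.restrict (Set.Ici (0:ℝ))) := by
    refine (stronglyMeasurable_deriv x).aestronglyMeasurable.congr ?_
    filter_upwards [hxae] with t ht
    exact ht.1.deriv
  have mxd2 : AEStronglyMeasurable (fun t => ‖xd t‖ ^ 2) (volume.restrict (Set.Ici (0:ℝ))) :=
    mxd.norm.pow 2
  have mB : AEStronglyMeasurable (fun t => lam t * beta t * ⟪B (x t), x t - z⟫)
      (volume.restrict (Set.Ici (0:ℝ))) :=
    ((cl.mul cb).mul (cBx.inner cw)).aestronglyMeasurable measurableSet_Ici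
  have mB2 : AEStronglyMeasurable (fun t => lam t * beta t * ‖B (x t)‖ ^ 2)
      (volume.restrict (Set.Ici (0:ℝ))) :=
    ((cl.mul cb).mul (cBx.norm.pow 2)).aestronglyMeasurable measurableSet_Ici
  have hBnn : ∀ t, 0 ≤ t → 0 ≤ lam t * beta t * ⟪B (x t), x t - z⟫ := by
    intro t ht
    rw [real_inner_comm]
    exact mul_nonneg (mul_nonneg (hlam_pos t ht).le (hbeta_pos t ht).le) (hmonoB0 _)
  obtain ⟨⟨L, hL⟩, hFint⟩ := aux_scalar (fun t => ‖x t - z‖ ^ 2) (fun t => 2 * ⟪x t - z, xd t⟫)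
    (fun t => 8 * (η⁻¹) ^ 2 * lam t ^ 2)
    (fun t => 8 * ‖p‖ ^ 2 * lam t ^ 2 + 1 / 3 * max (G t) 0 + R t) F
    (fun b hb => aux_ac_sq (hac b hb) z) (fun t => by positivity) (fun t => by positivity)
    (fun t => by have := hR0 t; positivity)
    (fun t ht => by
      have := hBnn t ht
      simp only [F]
      positivity)
    (Integrable.const_mul hH3.1 _)
    (Integrable.congr (Integrable.add (Integrable.add (Integrable.const_mul hH3.1 (8 * ‖p‖ ^ 2))
      (Integrable.const_mul hG (1 / 3))) hR) (Eventually.of_forall fun t => rfl))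
    ((mxd2.const_mul _).add (mB.const_mul _))
    (by
      filter_upwards [hxae, ae_restrict_mem measurableSet_Ici] with t ht ht0
      have ht0' : (0:ℝ) ≤ t := ht0
      obtain ⟨hd, hin⟩ := ht
      refine ⟨(hd.sub_const z).norm_sq, ?_⟩
      obtain ⟨w, hw, hweq⟩ := Set.mem_smul_set.1 hin
      have hl := hlam_pos t ht0
      have hm := hA.1 hw hv
      have hv' : v = -(D z) - p := by
        rw [eq_sub_iff_add_eq, eq_neg_iff_add_eq_zero, ← hvp]; abel
      refine aux_point (μ := μ) hη hl (mul_pos hl (hbeta_pos t ht0)) (x t - z) (xd t)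
        (D (x t) - D z) (B (x t)) p ?_ ?_ (aux_lip hη hD _ _) (hmonoB _) (hmonoB0 _) ?_
      · have h1 : -xd t - lam t • (D (x t) - D z) - (lam t * beta t) • B (x t) + lam t • p =
            lam t • (w - v) := by
          rw [smul_sub (lam t) w v, hweq, hv', smul_sub, smul_sub, smul_neg]; abel
        rw [h1, inner_smul_right]
        have h2 : xd t + (x t - z) = xd t + x t - z := by abel
        rw [h2]
        exact mul_nonneg hl.le hm
      · exact le_trans (by positivity) (hD (x t) z)
      · by_cases htT : t ≤ T
        · right
          exact Set.indicator_of_mem (show t ∈ Set.Icc 0 T from ⟨ht0', htT⟩) r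
        · left
          exact ⟨hT t (not_le.1 htT).le, hR0 t⟩)
  have hc : IntegrableOn (fun t => lam t * beta t * ⟪B (x t), x t - z⟫) (Set.Ici (0:ℝ)) := by
    refine Integrable.mono' (Integrable.const_mul hFint 3) mB ?_
    filter_upwards [ae_restrict_mem measurableSet_Ici] with t ht
    rw [Real.norm_of_nonneg (hBnn t ht)]
    have : 0 ≤ ‖xd t‖ ^ 2 := by positivity
    simp only [F]; linarith
  refine ⟨⟨√L, ?_⟩, ?_, hc, ?_⟩
  · refine ((Real.continuous_sqrt.tendsto L).comp hL).congr fun t => ?_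
    simp [Real.sqrt_sq (norm_nonneg _)]
  · refine Integrable.mono' (Integrable.const_mul hFint 4) mxd2 ?_
    filter_upwards [ae_restrict_mem measurableSet_Ici] with t ht
    rw [Real.norm_of_nonneg (by positivity)]
    have := hBnn t ht
    simp only [F]; linarith
  · refine Integrable.mono' (Integrable.const_mul hc μ⁻¹) mB2 ?_
    filter_upwards [ae_restrict_mem measurableSet_Ici] with t ht
    have hab := mul_nonneg (hlam_pos t ht).le (hbeta_pos t ht).le
    rw [Real.norm_of_nonneg (mul_nonneg hab (by positivity)), inv_mul_eq_div, le_div_iff₀ hμ,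
      real_inner_comm]
    have := mul_le_mul_of_nonneg_left (hmonoB (x t)) hab
    linarith
end

section
/- Assume (H1), (H2), (H3), (H_fitz), suppose limsup_{t→∞} λ(t)β(t) < 2μ, let x be a strong global solution of the dynamical system, and assume in addition that A is γ-strongly monotone for some γ > 0. Then zer(A + D + N_C) consists of a single element z, and x(t) converges strongly (in norm) to z as t → ∞. -/
open scoped RealInnerProductSpace Pointwise
open MeasureTheory Filter

variable {H : Type*} [NormedAddCommGroup H] [InnerProductSpace ℝ H]

lemma ac_convert (x : ℝ → H) (b : ℝ) (hb : 0 < b) (hx : AbsolutelyContinuousOnIcc x b) :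
    AbsolutelyContinuousOnInterval x 0 b := by
  rw [absolutelyContinuousOnInterval_iff]
  intro ε hε
  obtain ⟨δ, hδ, h⟩ := hx ε hε
  refine ⟨δ, hδ, ?_⟩
  rintro ⟨n, I⟩ ⟨hE1, hE2⟩ hsum
  simp only [Finset.mem_range, Set.uIcc_of_le hb.le] at hE1 hE2 hsum ⊢
  have key := h n (fun k => min (I k).1 (I k).2) (fun k => max (I k).1 (I k).2) ?_ ?_ ?_
  · rw [← Fin.sum_univ_eq_sum_range (fun i => dist (x (I i).1) (x (I i).2))]
    refine lt_of_eq_of_lt (Finset.sum_congr rfl fun k _ => ?_) key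
    rcases le_total (I k).1 (I k).2 with h' | h'
    · simp [h', dist_eq_norm, norm_sub_rev]
    · simp [h', dist_eq_norm]
  · intro k
    obtain ⟨h1, h2⟩ := hE1 k k.2
    exact ⟨le_min h1.1 h2.1, min_le_max, max_le h1.2 h2.2⟩
  · intro i j hij
    have := hE2 (x := (i : ℕ)) (by simp) (y := (j : ℕ)) (by simp) (by simpa [Fin.ext_iff] using hij)
    exact this.mono (Set.Ioo_subset_Ioc_self) (Set.Ioo_subset_Ioc_self)
  · rw [← Fin.sum_univ_eq_sum_range (fun i => dist (I i).1 (I i).2)] at hsum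
    refine lt_of_eq_of_lt (Finset.sum_congr rfl fun k _ => ?_) hsum
    rw [Real.dist_eq, max_sub_min_eq_abs']

lemma ac_norm_s11 (x : ℝ → H) (z : H) (b : ℝ) (hx : AbsolutelyContinuousOnInterval x 0 b) :
    AbsolutelyContinuousOnInterval (fun t => ‖x t - z‖) 0 b := by
  refine squeeze_zero (fun t => Finset.sum_nonneg fun i _ => dist_nonneg) (fun t => ?_) hx
  refine Finset.sum_le_sum fun i _ => ?_
  rw [Real.dist_eq, dist_eq_norm]
  refine (abs_norm_sub_norm_le _ _).trans (by simp)

lemma ac_antitone {f f' : ℝ → ℝ} {a b : ℝ} (hab : a ≤ b)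
    (hf : AbsolutelyContinuousOnInterval f a b)
    (h : ∀ᵐ t, t ∈ Set.Icc a b → HasDerivAt f (f' t) t ∧ f' t ≤ 0) : f b ≤ f a := by
  have h1 := hf.integral_deriv_eq_sub
  have h2 : ∫ t in a..b, deriv f t ≤ 0 := by
    rw [intervalIntegral.integral_of_le hab]
    refine setIntegral_nonpos_ae measurableSet_Ioc ?_
    filter_upwards [h] with t ht hm
    obtain ⟨h3, h4⟩ := ht (Set.Ioc_subset_Icc_self hm)
    rw [h3.deriv]; exact h4
  linarith

lemma ac_of_c1 {f f' : ℝ → ℝ} (hf : ∀ t, HasDerivAt f (f' t) t) (hc : Continuous f') (a b : ℝ) :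
    AbsolutelyContinuousOnInterval f a b := by
  obtain ⟨C, hC⟩ := (isCompact_uIcc (a := a) (b := b)).exists_bound_of_continuousOn hc.continuousOn
  have : LipschitzOnWith (Real.toNNReal C) f (Set.uIcc a b) := by
    refine Convex.lipschitzOnWith_of_nnnorm_hasDerivWithin_le (f' := f') (convex_uIcc a b)
      (fun t _ => (hf t).hasDerivWithinAt) (fun t ht => ?_)
    rw [← NNReal.coe_le_coe, coe_nnnorm]
    exact (hC t ht).trans (Real.le_coe_toNNReal C)
  exact this.absolutelyContinuousOnInterval

lemma scalar_decay (l b h hd : ℝ → ℝ) (c K T : ℝ) (hc : 0 < c) (hK : 0 ≤ K) (hT : 0 < T)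
    (hl : Continuous l) (hb : Continuous b) (hl0 : ∀ t, 0 ≤ l t) (hb0 : ∀ t, 0 ≤ b t)
    (hh0 : ∀ t, 0 ≤ h t)
    (hac : ∀ r > 0, AbsolutelyContinuousOnInterval h 0 r)
    (hder : ∀ᵐ t, T ≤ t → HasDerivAt h (hd t) t ∧ 
      hd t ≤ - (c * l t * h t) + K * l t ^ 2 * h t + b t)
    (hl2 : IntegrableOn (fun t => l t ^ 2) (Set.Ioi 0))
    (hbi : IntegrableOn b (Set.Ioi 0))
    (hli : ¬ IntegrableOn l (Set.Ioi 0)) : Tendsto h atTop (nhds 0) := by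
  set L : ℝ → ℝ := fun t => ∫ s in (0:ℝ)..t, l s with hL
  set Q : ℝ → ℝ := fun t => ∫ s in (0:ℝ)..t, l s ^ 2 with hQ
  have dL : ∀ t, HasDerivAt L (l t) t := fun t => hl.integral_hasStrictDerivAt 0 t |>.hasDerivAt
  have dQ : ∀ t, HasDerivAt Q (l t ^ 2) t :=
    fun t => (hl.pow 2).integral_hasStrictDerivAt 0 t |>.hasDerivAt
  have cL : Continuous L := continuous_iff_continuousAt.2 fun t => (dL t).continuousAt
  have cQ : Continuous Q := continuous_iff_continuousAt.2 fun t => (dQ t).continuousAt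
  have mL : Monotone L := monotone_of_deriv_nonneg (fun t => (dL t).differentiableAt)
    (fun t => by rw [(dL t).deriv]; exact hl0 t)
  have mQ : Monotone Q := monotone_of_deriv_nonneg (fun t => (dQ t).differentiableAt)
    (fun t => by rw [(dQ t).deriv]; positivity)
  set q := ∫ s in Set.Ioi (0:ℝ), l s ^ 2 with hq
  have Qq : ∀ t, Q t ≤ q := fun t =>
    mQ.ge_of_tendsto (intervalIntegral_tendsto_integral_Ioi 0 hl2 tendsto_id) t
  have Ltop : Tendsto L atTop atTop := by
    rcases tendsto_atTop_of_monotone mL with h' | ⟨v, hv⟩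
    · exact h'
    · exfalso; apply hli
      refine integrableOn_Ioi_of_intervalIntegral_norm_tendsto (f := l) v 0 (b := id) (l := atTop) ?_ tendsto_id ?_
      · intro t; exact (hl.integrableOn_Icc (a := 0) (b := t)).mono_set Set.Ioc_subset_Icc_self
      · refine hv.congr fun t => ?_
        simp only [hL, id]
        exact intervalIntegral.integral_congr fun s _ => by simp [abs_of_nonneg (hl0 s)]
  set u : ℝ → ℝ := fun t => Real.exp (c * L t - K * Q t) with hu
  have du : ∀ t, HasDerivAt u (u t * (c * l t - K * l t ^ 2)) t := fun t =>
    (((dL t).const_mul c).sub ((dQ t).const_mul K)).exp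
  have cu : Continuous u := by fun_prop
  have u0 : ∀ t, 0 < u t := fun t => Real.exp_pos _
  have main : ∀ s t, T ≤ s → s ≤ t → u t * h t ≤ u s * h s + ∫ r in s..t, u r * b r := by
    intro s t hs hst
    have dI : ∀ t, HasDerivAt (fun t => ∫ r in s..t, u r * b r) (u t * b t) t := fun t =>
      (cu.mul hb).integral_hasStrictDerivAt s t |>.hasDerivAt
    have acu := ac_of_c1 du (by fun_prop) s t
    have acI := ac_of_c1 dI (by fun_prop) s t
    have ach : AbsolutelyContinuousOnInterval h s t := by
      refine (hac t (by linarith)).mono ?_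
      rw [Set.uIcc_of_le hst, Set.uIcc_of_le (by linarith)]
      exact Set.Icc_subset_Icc_left (by linarith)
    have := ac_antitone (f' := fun t => u t * (c * l t - K * l t ^ 2) * h t + u t * hd t - u t * b t)
      hst ((acu.fun_mul ach).fun_sub acI) ?_
    · simp only [intervalIntegral.integral_same] at this
      linarith
    · filter_upwards [hder] with r hr hm
      obtain ⟨h1, h2⟩ := hr (hs.trans hm.1)
      refine ⟨((du r).mul h1).sub (dI r), ?_⟩
      nlinarith [u0 r]
  set M := Real.exp (K * q) with hM
  have uM : ∀ r t, 0 ≤ r → r ≤ t → u r ≤ M * u t := by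
    intro r t hr hrt
    simp only [hM, hu]
    rw [← Real.exp_add]
    apply Real.exp_le_exp.2
    have h0 : 0 ≤ Q r := by simpa [hQ] using mQ hr
    have h1 := mul_le_mul_of_nonneg_left (mL hrt) hc.le
    have h2 := mul_le_mul_of_nonneg_left (Qq t) hK
    nlinarith [mul_nonneg hK h0]
  have M0 : 0 < M := Real.exp_pos _
  have main2 : ∀ s t, T ≤ s → s ≤ t → h t ≤ u s * h s * (u t)⁻¹ + M * ∫ r in s..t, b r := by
    intro s t hs hst
    have h1 := main s t hs hst
    have h2 : ∫ r in s..t, u r * b r ≤ ∫ r in s..t, (M * u t) * b r := by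
      refine intervalIntegral.integral_mono_on hst ((cu.mul hb).intervalIntegrable _ _)
        ((hb.const_mul (M * u t)).intervalIntegrable _ _) fun r hr => ?_
      exact mul_le_mul_of_nonneg_right (uM r t (by linarith [hr.1]) hr.2) (hb0 r)
    rw [intervalIntegral.integral_const_mul] at h2
    have h3 := u0 t
    have h4 : u t * h t ≤ u t * (u s * h s * (u t)⁻¹ + M * ∫ r in s..t, b r) := by
      refine (h1.trans (add_le_add_right h2 _)).trans (le_of_eq ?_)
      field_simp
    exact le_of_mul_le_mul_left h4 h3
  have utop : Tendsto u atTop atTop := by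
    refine Real.tendsto_exp_atTop.comp ?_
    refine tendsto_atTop_mono (f := fun t => c * L t + (- (K * q))) (fun t => ?_)
      (tendsto_atTop_add_const_right _ _ (Ltop.const_mul_atTop hc))
    have h2 := mul_le_mul_of_nonneg_left (Qq t) hK
    linarith
  have uinv : Tendsto (fun t => (u t)⁻¹) atTop (nhds 0) := tendsto_inv_atTop_zero.comp utop
  set R : ℝ → ℝ := fun t => ∫ s in (0:ℝ)..t, b s with hR
  have dR : ∀ t, HasDerivAt R (b t) t := fun t => hb.integral_hasStrictDerivAt 0 t |>.hasDerivAt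
  have mR : Monotone R := monotone_of_deriv_nonneg (fun t => (dR t).differentiableAt)
    (fun t => by rw [(dR t).deriv]; exact hb0 t)
  set w := ∫ s in Set.Ioi (0:ℝ), b s with hw
  have Rt : Tendsto R atTop (nhds w) := intervalIntegral_tendsto_integral_Ioi 0 hbi tendsto_id
  have Rw : ∀ t, R t ≤ w := fun t => mR.ge_of_tendsto Rt t
  rw [Metric.tendsto_atTop]
  intro ε hε
  have e1 : ∀ᶠ s in atTop, w - ε / 2 / M < R s :=
    Rt.eventually (lt_mem_nhds (by have : 0 < ε / 2 / M := by positivity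
                                   linarith))
  obtain ⟨s, hs1, hs2⟩ := (e1.and (eventually_ge_atTop T)).exists
  have e2 : Tendsto (fun t => u s * h s * (u t)⁻¹) atTop (nhds 0) := by
    simpa using uinv.const_mul (u s * h s)
  obtain ⟨N, hN⟩ := eventually_atTop.1 ((e2.eventually (gt_mem_nhds (half_pos hε))).and
    (eventually_ge_atTop s))
  refine ⟨N, fun t ht => ?_⟩
  obtain ⟨h1, h2⟩ := hN t ht
  have h3 := main2 s t hs2 h2
  have h4 : ∫ r in s..t, b r = R t - R s :=
    (intervalIntegral.integral_interval_sub_left (hb.intervalIntegrable _ _)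
      (hb.intervalIntegrable _ _)).symm
  rw [h4] at h3
  have h5 : M * (R t - R s) ≤ ε / 2 := by
    have : R t - R s ≤ ε / 2 / M := by linarith [Rw t]
    calc M * (R t - R s) ≤ M * (ε / 2 / M) := mul_le_mul_of_nonneg_left this M0.le
      _ = ε / 2 := by field_simp
  rw [Real.dist_eq, sub_zero, abs_of_nonneg (hh0 t)]
  linarith

lemma young_aux (s μ N n i j : ℝ) (hs : 0 < s) (hsm : s ≤ 2 * μ) (hi : -(N * n) ≤ i)
    (hj : μ * n ^ 2 ≤ j) : -(s * i) ≤ 3 / 4 * N ^ 2 + 3 / 4 * (s * j) := by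
  have k1 := mul_le_mul_of_nonneg_left hi hs.le
  have k2 := mul_le_mul_of_nonneg_left hj hs.le
  have k3 := mul_le_mul_of_nonneg_right hsm (mul_nonneg hs.le (sq_nonneg n))
  have k4 : 0 ≤ s * (s * n ^ 2) := by positivity
  have k5 := sq_nonneg (3 * N - 2 * s * n)
  linarith

/-- The gap term controlled by the Fitzpatrick condition. -/
noncomputable def gapTerm (B : H → H) (z p x : H) (be : ℝ) : ℝ :=
  ⟪z, B x⟫ + ⟪x, be⁻¹ • ((4:ℝ) • p)⟫ - ⟪x, B x⟫ - ⟪z, be⁻¹ • ((4:ℝ) • p)⟫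

lemma pointwise_ineq (A : H → Set H) (η μ γ l be : ℝ) (hη : 0 < η) (hγ : 0 < γ)
    (D B : H → H) (hD : Cocoercive η D) (hB : Cocoercive μ B) (hl : 0 < l) (hbe : 0 < be)
    (hlb : l * be ≤ 2 * μ) (hsm : StronglyMonotoneOperator γ A) (x y z v p : H)
    (hv : v ∈ A z) (hz : B z = 0) (hvp : v + D z + p = 0)
    (hincl : x - l • D x - (l * be) • B x - (y + x) ∈ l • A (y + x)) :
    ⟪x - z, y⟫ ≤ -(γ * l * ‖x - z‖ ^ 2) + (3 / η ^ 2 + 12 * γ ^ 2) * l ^ 2 * ‖x - z‖ ^ 2 +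
      (l * be / 4 * max 0 (gapTerm B z p x be) + 3 * l ^ 2 * ‖p‖ ^ 2) := by
  obtain ⟨a, ha, hae⟩ := hincl
  simp only at hae
  have h1 := hsm ha hv
  obtain ⟨X, rfl⟩ : ∃ X, x = X + z := ⟨x - z, by simp⟩
  have h2 := hD (X + z) z
  have h3 := hB (X + z) z
  rw [hz] at h3
  have hw : l * be / 4 * gapTerm B z p (X + z) be =
      -(l * be / 4) * ⟪X, B (X + z)⟫ + l * ⟪X, p⟫ := by
    simp only [gapTerm, inner_add_left, inner_smul_right]
    field_simp
    ring
  have hw2 : l * be / 4 * gapTerm B z p (X + z) be ≤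
      l * be / 4 * max 0 (gapTerm B z p (X + z) be) :=
    mul_le_mul_of_nonneg_left (le_max_right _ _) (by positivity)
  generalize max 0 (gapTerm B z p (X + z) be) = W at *
  generalize gapTerm B z p (X + z) be = w at *
  obtain ⟨d, hd⟩ : ∃ d, d = D (X + z) - D z := ⟨_, rfl⟩
  rw [← hd] at h2
  have hDx : D (X + z) = d + D z := by simp [hd]
  have hvv : v = -D z - p := by rw [← sub_eq_zero, ← hvp]; abel
  generalize B (X + z) = b at *
  have h4 : l • (a - v) = - l • d - (l * be) • b - y + l • p := by
    rw [smul_sub, hae, hvv, hDx]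
    module
  have e1 : y + (X + z) - z = X + y := by abel
  have e2 : X + z - z = X := by abel
  rw [e1] at h1
  rw [e2] at h2 h3 ⊢
  rw [sub_zero] at h3
  have h5 : l * ⟪X + y, a - v⟫ = ⟪X + y, - l • d - (l * be) • b - y + l • p⟫ := by
    rw [← h4, inner_smul_right]
  have h6 := mul_le_mul_of_nonneg_left h1 hl.le
  rw [h5, norm_add_sq_real] at h6
  simp only [inner_add_left, inner_add_right, inner_sub_right, inner_smul_right, 
    real_inner_self_eq_norm_sq, neg_smul, inner_neg_right] at h6
  -- Young inequalities
  have y1 : -(l * ⟪y, d⟫) ≤ ‖y‖ ^ 2 / 12 + 3 * l ^ 2 * ‖d‖ ^ 2 := by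
    have := abs_le.1 (abs_real_inner_le_norm y d)
    nlinarith [sq_nonneg (‖y‖ - 6 * l * ‖d‖), mul_le_mul_of_nonneg_left this.1 hl.le]
  have y2 : l * ⟪y, p⟫ ≤ ‖y‖ ^ 2 / 12 + 3 * l ^ 2 * ‖p‖ ^ 2 := by
    have := abs_le.1 (abs_real_inner_le_norm y p)
    nlinarith [sq_nonneg (‖y‖ - 6 * l * ‖p‖), mul_le_mul_of_nonneg_left this.2 hl.le]
  have y3 : -(2 * (l * γ) * ⟪X, y⟫) ≤ ‖y‖ ^ 2 / 12 + 12 * (l * γ) ^ 2 * ‖X‖ ^ 2 := by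
    have := abs_le.1 (abs_real_inner_le_norm X y)
    have hlg : 0 ≤ l * γ := by positivity
    nlinarith [sq_nonneg (‖y‖ - 12 * (l * γ) * ‖X‖), mul_le_mul_of_nonneg_left this.1 hlg]
  have y4 : -(l * be * ⟪y, b⟫) ≤ 3 / 4 * ‖y‖ ^ 2 + 3 / 4 * (l * be * ⟪X, b⟫) := by
    have := abs_le.1 (abs_real_inner_le_norm y b)
    exact young_aux _ _ _ _ _ _ (by positivity) hlb this.1 h3
  have y5 : ‖d‖ ≤ ‖X‖ / η := by
    rw [le_div_iff₀ hη]
    rcases (norm_nonneg d).eq_or_lt with h0 | h0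
    · rw [← h0]; simp
    · have := h2.trans (real_inner_le_norm X d)
      exact le_of_mul_le_mul_right (by nlinarith) h0
  have y6 : 3 * l ^ 2 * ‖d‖ ^ 2 ≤ 3 / η ^ 2 * l ^ 2 * ‖X‖ ^ 2 := by
    have : ‖d‖ ^ 2 ≤ (‖X‖ / η) ^ 2 := pow_le_pow_left₀ (norm_nonneg _) y5 2
    calc 3 * l ^ 2 * ‖d‖ ^ 2 ≤ 3 * l ^ 2 * (‖X‖ / η) ^ 2 := by gcongr
      _ = _ := by field_simp
  have y7 : 0 ≤ l * ⟪X, d⟫ := by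
    refine mul_nonneg hl.le (le_trans ?_ h2)
    positivity
  have y8 : 0 ≤ l * γ * ‖y‖ ^ 2 := by positivity
  linarith

lemma cocoercive_continuous {η : ℝ} (hη : 0 < η) {D : H → H} (hD : Cocoercive η D) :
    Continuous D := by
  have : LipschitzWith (Real.toNNReal η⁻¹) D := by
    refine LipschitzWith.of_dist_le_mul fun x y => ?_
    rw [Real.coe_toNNReal _ (by positivity), dist_eq_norm, dist_eq_norm, inv_mul_eq_div,
      le_div_iff₀ hη]
    rcases (norm_nonneg (D x - D y)).eq_or_lt with h0 | h0
    · rw [← h0]; simp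
    · have := (hD x y).trans (real_inner_le_norm _ _)
      exact le_of_mul_le_mul_right (by nlinarith) h0
  exact this.continuous

lemma gap_le_fitz (B : H → H) (z p x : H) (be : ℝ) (hbe : 0 < be)
    (hp : p ∈ normalCone {q : H | B q = 0} z) :
    ENNReal.ofReal (max 0 (gapTerm B z p x be)) ≤
      erealToENNReal ((⨆ u ∈ {q : H | B q = 0}, fitzpatrick B u (be⁻¹ • ((4:ℝ) • p))) -
          supportFn {q : H | B q = 0} (be⁻¹ • ((4:ℝ) • p))) := by
  obtain ⟨hz, hpz⟩ := hp
  have hs : supportFn {q : H | B q = 0} (be⁻¹ • ((4:ℝ) • p)) =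
      ((⟪z, be⁻¹ • ((4:ℝ) • p)⟫ : ℝ) : EReal) := by
    apply le_antisymm
    · refine iSup₂_le fun y hy => ?_
      rw [EReal.coe_le_coe_iff]
      have := hpz y hy
      rw [inner_sub_left] at this
      simp only [inner_smul_right]
      have h1 : 0 < be⁻¹ := by positivity
      nlinarith
    · exact le_iSup₂ (f := fun y (_ : y ∈ {q : H | B q = 0}) =>
        ((⟪y, be⁻¹ • ((4:ℝ) • p)⟫ : ℝ) : EReal)) z hz
  have hf : ((⟪z, B x⟫ + ⟪x, be⁻¹ • ((4:ℝ) • p)⟫ - ⟪x, B x⟫ : ℝ) : EReal) ≤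
      ⨆ u ∈ {q : H | B q = 0}, fitzpatrick B u (be⁻¹ • ((4:ℝ) • p)) := by
    refine le_trans ?_ (le_iSup₂ (f := fun u (_ : u ∈ {q : H | B q = 0}) =>
      fitzpatrick B u (be⁻¹ • ((4:ℝ) • p))) z hz)
    exact le_iSup (fun y : H =>
      ((⟪z, B y⟫ + ⟪y, be⁻¹ • ((4:ℝ) • p)⟫ - ⟪y, B y⟫ : ℝ) : EReal)) x
  have hg : ((gapTerm B z p x be : ℝ) : EReal) ≤
      (⨆ u ∈ {q : H | B q = 0}, fitzpatrick B u (be⁻¹ • ((4:ℝ) • p))) -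
          supportFn {q : H | B q = 0} (be⁻¹ • ((4:ℝ) • p)) := by
    rw [hs, gapTerm, EReal.coe_sub]
    exact EReal.sub_le_sub hf le_rfl
  rw [erealToENNReal]
  split_ifs with htop
  · exact le_top
  · rw [ENNReal.ofReal_max, ENNReal.ofReal_zero, max_eq_right zero_le]
    apply ENNReal.ofReal_le_ofReal
    have := EReal.toReal_le_toReal hg (EReal.coe_ne_bot _) htop
    simpa using this

lemma gap_cont (B : H → H) (z p : H) (l be : ℝ → ℝ) (X : ℝ → H) (hl : Continuous l)
    (hbe : Continuous be) (hb0 : ∀ t, 0 < be t) (hX : Continuous X) (hB : Continuous B) :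
    Continuous (fun t => l t * be t / 4 * max 0 (gapTerm B z p (X t) (be t))) := by
  have h1 : Continuous (fun t => (be t)⁻¹) := hbe.inv₀ fun t => (hb0 t).ne'
  unfold gapTerm
  fun_prop

lemma ext_cont {E : Type*} [TopologicalSpace E] (f : ℝ → E)
    (hf : ∀ r > 0, ContinuousOn f (Set.Icc 0 r)) : Continuous (fun t => f (max t 0)) := by
  have h1 : ContinuousOn f (Set.Ici 0) := by
    intro t ht
    have ht0 : (0:ℝ) ≤ t := ht
    have h2 := hf (t + 1) (by linarith) t ⟨ht, by linarith⟩
    refine h2.mono_of_mem_nhdsWithin ?_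
    have : Set.Iio (t + 1) ∈ nhds t := Iio_mem_nhds (by linarith)
    filter_upwards [self_mem_nhdsWithin, mem_nhdsWithin_of_mem_nhds this] with s hs1 hs2
    exact ⟨hs1, le_of_lt hs2⟩
  exact h1.comp_continuous (by fun_prop) (fun t => Set.mem_Ici.2 (le_max_right _ _))

/-- Theorem, part (iii): if `A` is `γ`-strongly monotone, then
`zer(A + D + N_C)` is a singleton `{z}` and `x(t)` converges strongly to `z`. -/
theorem main_theorem_part_iii [CompleteSpace H]
    (A : H → Set H) (hA : MaximallyMonotone A)
    (η μ : ℝ) (hη : 0 < η) (hμ : 0 < μ)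
    (D B : H → H) (hD : Cocoercive η D) (hB : Cocoercive μ B)
    (hC : {q : H | B q = 0}.Nonempty)
    (lam beta : ℝ → ℝ)
    (hlam_pos : ∀ t : ℝ, 0 ≤ t → 0 < lam t) (hbeta_pos : ∀ t : ℝ, 0 ≤ t → 0 < beta t)
    (hH1 : ∀ b > (0:ℝ), ContinuousOn lam (Set.Icc 0 b) ∧ ContinuousOn beta (Set.Icc 0 b))
    (hH2 : MaximallyMonotone (fun q => A q + normalCone {q' : H | B q' = 0} q) ∧
      (zerSum A D {q : H | B q = 0}).Nonempty)
    (hH3 : IntegrableOn (fun t => lam t ^ 2) (Set.Ici (0:ℝ)) volume ∧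
      ∫⁻ t in Set.Ici (0:ℝ), ENNReal.ofReal (lam t) = ⊤)
    (hfitz : ∀ p z : H, p ∈ normalCone {q : H | B q = 0} z →
      ∫⁻ t in Set.Ici (0:ℝ), ENNReal.ofReal (lam t * beta t) *
        erealToENNReal ((⨆ u ∈ {q : H | B q = 0}, fitzpatrick B u ((beta t)⁻¹ • p)) -
          supportFn {q : H | B q = 0} ((beta t)⁻¹ • p)) < ⊤)
    (hls : limsup (fun t => ((lam t * beta t : ℝ) : EReal)) atTop < ((2 * μ : ℝ) : EReal))
    (x₀ : H) (x xd : ℝ → H)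
    (hsol : IsStrongGlobalSolution A D B lam beta x₀ x xd)
    (γ : ℝ) (hγ : 0 < γ) (hsm : StronglyMonotoneOperator γ A) :
    ∃ z : H, zerSum A D {q : H | B q = 0} = {z} ∧ Tendsto x atTop (nhds z) := by
  obtain ⟨hH2a, z, v, hv, p, hp, hvp⟩ := hH2
  have hz : B z = 0 := hp.1
  refine ⟨z, ?_, ?_⟩
  · ext z'
    simp only [Set.mem_singleton_iff]
    constructor
    · rintro ⟨v', hv', p', hp', hvp'⟩
      have h1 := hsm hv' hv
      have h2 := hD z' z
      have h3 := hp'.2 z hp.1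
      have h4 := hp.2 z' hp'.1
      have e1 : v' - v = -(D z' - D z) - p' + p := by
        have e2 : v = -D z - p := by rw [← sub_eq_zero, ← hvp]; abel
        have e3 : v' = -D z' - p' := by rw [← sub_eq_zero, ← hvp']; abel
        rw [e2, e3]; abel
      have e4 : ⟪z - z', p'⟫ = -⟪z' - z, p'⟫ := by rw [← inner_neg_left, neg_sub]
      rw [e1, inner_add_right, inner_sub_right, inner_neg_right] at h1
      rw [e4] at h3
      have h5 : 0 ≤ η * ‖D z' - D z‖ ^ 2 := by positivity
      have h6 : γ * ‖z' - z‖ ^ 2 ≤ 0 := by linarith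
      have h7 : ‖z' - z‖ ^ 2 ≤ 0 := by
        by_contra hcon
        push Not at hcon
        nlinarith [mul_pos hγ hcon]
      have h8 : ‖z' - z‖ = 0 := by
        have := sq_nonneg ‖z' - z‖
        exact pow_eq_zero_iff (two_ne_zero) |>.1 (le_antisymm h7 this)
      exact sub_eq_zero.1 (norm_eq_zero.1 h8)
    · rintro rfl
      exact ⟨v, hv, p, hp, hvp⟩
  · obtain ⟨hac, -, hsol⟩ := hsol
    have hacx : ∀ r > 0, AbsolutelyContinuousOnInterval x 0 r := fun r hr =>
      ac_convert x r hr (hac r hr)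
    have cl := ext_cont lam fun r hr => (hH1 r hr).1
    have cb := ext_cont beta fun r hr => (hH1 r hr).2
    have cx := ext_cont x fun r hr => by
      have := (hacx r hr).continuousOn
      rwa [Set.uIcc_of_le (le_of_lt hr)] at this
    have cB := cocoercive_continuous hμ hB
    have l0 : ∀ t, 0 < lam (max t 0) := fun t => hlam_pos _ (le_max_right _ _)
    have b0 : ∀ t, 0 < beta (max t 0) := fun t => hbeta_pos _ (le_max_right _ _)
    have cbi : Continuous (fun t => (beta (max t 0))⁻¹) := cb.inv₀ fun t => (b0 t).ne'
    have cBx : Continuous (fun t => B (x (max t 0))) := cB.comp cx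
    have cgap : Continuous (fun t => lam (max t 0) * beta (max t 0) / 4 *
        max 0 (gapTerm B z p (x (max t 0)) (beta (max t 0)))) := by
      exact gap_cont B z p (fun t => lam (max t 0)) (fun t => beta (max t 0))
        (fun t => x (max t 0)) cl cb b0 cx cB
    have mx : ∀ {t : ℝ}, 0 < t → max t 0 = t := fun h => max_eq_left h.le
    -- bound from the limsup
    obtain ⟨T, hT⟩ := eventually_atTop.1 (eventually_lt_of_limsup_lt hls)
    have hI : ∀ f : ℝ → ℝ, IntegrableOn (fun t => f (max t 0)) (Set.Ioi 0) ↔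
        IntegrableOn f (Set.Ioi 0) := fun f =>
      integrableOn_congr_fun (fun t ht => by simp only [mx ht]) measurableSet_Ioi
    have il2 : IntegrableOn (fun t => lam (max t 0) ^ 2) (Set.Ioi 0) :=
      (hI (fun t => lam t ^ 2)).2 (hH3.1.mono_set Set.Ioi_subset_Ici_self)
    have igap : IntegrableOn (fun t => lam (max t 0) * beta (max t 0) / 4 *
        max 0 (gapTerm B z p (x (max t 0)) (beta (max t 0)))) (Set.Ioi 0) := by
      refine ⟨cgap.aestronglyMeasurable, ?_⟩
      rw [hasFiniteIntegral_iff_ofReal]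
      swap
      · filter_upwards with t
        have := l0 t
        have := b0 t
        positivity
      have hp4 : (4:ℝ) • p ∈ normalCone {q : H | B q = 0} z := by
        refine ⟨hp.1, fun y hy => ?_⟩
        rw [inner_smul_right]
        linarith [hp.2 y hy]
      refine lt_of_le_of_lt ?_ (hfitz ((4:ℝ) • p) z hp4)
      refine le_trans ?_ (lintegral_mono_set Set.Ioi_subset_Ici_self)
      refine setLIntegral_mono' measurableSet_Ioi fun t ht => ?_
      rw [mx ht]
      have h1 := hlam_pos t (le_of_lt ht)
      have h2 := hbeta_pos t (le_of_lt ht)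
      rw [ENNReal.ofReal_mul (by positivity)]
      refine mul_le_mul' (ENNReal.ofReal_le_ofReal ?_) (gap_le_fitz B z p (x t) (beta t) h2 hp)
      have : 0 < lam t * beta t := by positivity
      linarith
    have inl : ¬ IntegrableOn (fun t => lam (max t 0)) (Set.Ioi 0) := by
      intro hi
      have hi' := ((hI lam).1 hi).2
      rw [hasFiniteIntegral_iff_ofReal] at hi'
      · rw [setLIntegral_congr (Ioi_ae_eq_Ici (a := (0:ℝ))), hH3.2] at hi'
        exact lt_irrefl _ hi'
      · filter_upwards [ae_restrict_mem measurableSet_Ioi] with t ht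
        exact (hlam_pos t (le_of_lt ht)).le
    have hsol' := (ae_restrict_iff' measurableSet_Ici).1 hsol
    have key := scalar_decay (fun t => lam (max t 0))
      (fun t => lam (max t 0) * beta (max t 0) / 4 *
        max 0 (gapTerm B z p (x (max t 0)) (beta (max t 0))) + 3 * lam (max t 0) ^ 2 * ‖p‖ ^ 2)
      (fun t => 1 / 2 * (‖x t - z‖ * ‖x t - z‖)) (fun t => ⟪x t - z, xd t⟫)
      (2 * γ) (2 * (3 / η ^ 2 + 12 * γ ^ 2)) (max T 1) (by positivity) (by positivity)
      (by positivity) cl (cgap.add (((cl.pow 2).const_mul 3).mul_const _)) (fun t => (l0 t).le)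
      (fun t => by
        have := l0 t
        have := b0 t
        positivity)
      (fun t => by positivity)
      (fun r hr => ((ac_norm_s11 x z r (hacx r hr)).fun_mul (ac_norm_s11 x z r (hacx r hr))).const_mul _)
      ?_ il2 (igap.add ((il2.const_mul 3).mul_const _)) inl
    · have h1 : Tendsto (fun t => ‖x t - z‖ ^ 2) atTop (nhds 0) := by
        have := key.const_mul 2
        simp only [mul_zero] at this
        refine this.congr fun t => by ring
      have h2 : Tendsto (fun t => ‖x t - z‖) atTop (nhds 0) := by
        have := h1.sqrt
        simpa using this
      exact tendsto_iff_norm_sub_tendsto_zero.2 h2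
    · filter_upwards [hsol'] with t ht htT
      have ht0 : 0 < t := by linarith [le_max_right T 1]
      obtain ⟨hd, hincl⟩ := ht ht0.le
      refine ⟨?_, ?_⟩
      · have h1 := (hd.sub_const z).norm_sq.const_mul (1 / 2 : ℝ)
        have h2 : (fun t => 1 / 2 * (‖x t - z‖ * ‖x t - z‖)) =
          fun t => 1 / 2 * ‖x t - z‖ ^ 2 := by ext t; ring
        rw [h2]
        exact h1.congr_deriv (by ring)
      · simp only [mx ht0]
        have h1 : lam t * beta t < 2 * μ := by
          have := hT t ((le_max_left _ _).trans htT)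
          exact_mod_cast this
        have := pointwise_ineq A η μ γ (lam t) (beta t) hη hγ D B hD hB (hlam_pos t ht0.le)
          (hbeta_pos t ht0.le) h1.le hsm (x t) (xd t) z v p hv hz hvp hincl
        refine this.trans (le_of_eq ?_)
        ring
end
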